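/- arXiv:0707.0718 — 3 statements merged into one kernel-verified Lean document; each statement's English description precedes it below -/
import Mathlib

section
/- Let p be a prime and (M,Q) a nondegenerate finite quadratic module whose order is a power of p and which can be generated as an abelian group by at most two elements (equivalently, dim_{F_p} M ⊗ F_p ≤ 2). Then Inv(M) ≠ 0 if and only if |M| is a perfect square and σ(M) = 1. -/
noncomputable section

/-- `ℚ/ℤ` as the additive circle of circumference 1. -/
abbrev QZ : Type := AddCircle (1 : ℚ)

lemma expPeriodic : Function.Periodic
    (fun q : ℚ => Complex.exp (2 * Real.pi * Complex.I * (q : ℂ))) 1 := by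
  intro x
  push_cast
  rw [mul_add, Complex.exp_add, mul_one, Complex.exp_two_pi_mul_I, mul_one]

/-- The standard character `e : ℚ/ℤ → ℂ`, `e(t) = exp(2πi t)`. -/
def ee : QZ → ℂ := expPeriodic.lift

variable {M : Type} [AddCommGroup M]

/-- The bilinear form associated to a quadratic form `Q : M → ℚ/ℤ`. -/
def Bf (Q : M → QZ) (x y : M) : QZ := Q (x + y) - Q x - Q y

/-- The Gauss sum `σ(M) = |M|^{-1/2} ∑_{x ∈ M} e(-Q(x))`. -/
def gaussSigma (Q : M → QZ) : ℂ :=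
  ((Real.sqrt (Nat.card M) : ℂ))⁻¹ * ∑ᶠ x : M, ee (-(Q x))

/-- The operator `T_M` of the Weil representation: `(T_M λ)(x) = e(Q(x))·λ(x)`. -/
def Tweil (Q : M → QZ) (lam : M → ℂ) : M → ℂ := fun x => ee (Q x) * lam x

/-- The operator `S_M` of the Weil representation:
`(S_M λ)(y) = σ(M)·|M|^{-1/2}·∑_{x∈M} e(-B(y,x))·λ(x)`. -/
def Sweil (Q : M → QZ) (lam : M → ℂ) : M → ℂ := fun y =>
  gaussSigma Q * ((Real.sqrt (Nat.card M) : ℂ))⁻¹ *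
    ∑ᶠ x : M, ee (-(Bf Q y x)) * lam x

/-- The `p`-primary component of an abelian group, as a subgroup. -/
def primaryComp (M : Type) [AddCommGroup M] (p : ℕ) : AddSubgroup M where
  carrier := {x | ∃ k : ℕ, (p ^ k : ℕ) • x = 0}
  zero_mem' := ⟨0, smul_zero _⟩
  add_mem' := by
    rintro a b ⟨k, hk⟩ ⟨l, hl⟩
    refine ⟨k + l, ?_⟩
    have ha : (p ^ (k + l) : ℕ) • a = 0 := by
      rw [pow_add, mul_comm, mul_smul, hk, smul_zero]
    have hb : (p ^ (k + l) : ℕ) • b = 0 := by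
      rw [pow_add, mul_smul, hl, smul_zero]
    rw [smul_add, ha, hb, add_zero]
  neg_mem' := by
    rintro a ⟨k, hk⟩
    exact ⟨k, by rw [smul_neg, hk, neg_zero]⟩

end


section

lemma ee_coe (q : ℚ) : ee (q : QZ) = Complex.exp (2 * Real.pi * Complex.I * (q : ℂ)) :=
  expPeriodic.lift_coe q

lemma ee_zero : ee 0 = 1 := by
  have := ee_coe 0
  simpa using this

lemma ee_add (a b : QZ) : ee (a + b) = ee a * ee b := by
  induction a using QuotientAddGroup.induction_on with | _ a =>
  induction b using QuotientAddGroup.induction_on with | _ b =>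
  have := ee_coe (a + b)
  refine this.trans ?_
  refine Eq.trans ?_ (congrArg₂ (· * ·) (ee_coe a).symm (ee_coe b).symm)
  rw [← Complex.exp_add]; push_cast; ring_nf

lemma ee_eq_one {a : QZ} (h : ee a = 1) : a = 0 := by
  induction a using QuotientAddGroup.induction_on with | _ a =>
  have h2 := (ee_coe a).symm.trans h
  rw [Complex.exp_eq_one_iff] at h2
  obtain ⟨n, hn⟩ := h2
  have h3 : (a : ℂ) = n := by
    have : (2 * Real.pi * Complex.I : ℂ) ≠ 0 := Complex.two_pi_I_ne_zero
    apply mul_left_cancel₀ this; rw [hn]; ring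
  have h4 : a = n := by exact_mod_cast h3
  refine (AddCircle.coe_eq_zero_iff (1:ℚ)).2 ⟨n, ?_⟩
  simp [h4]

lemma ee_neg (a : QZ) : ee (-a) = (ee a)⁻¹ := by
  have : ee (-a) * ee a = 1 := by rw [← ee_add]; simp [ee_zero]
  exact eq_inv_of_mul_eq_one_left this

lemma ee_norm (a : QZ) : ‖ee a‖ = 1 := by
  induction a using QuotientAddGroup.induction_on with | _ a =>
  refine (congrArg norm (ee_coe a)).trans ?_
  rw [show (2 * Real.pi * Complex.I * (a:ℂ)) = ((2 * Real.pi * (a:ℝ) : ℝ) : ℂ) * Complex.I by push_cast; ring]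
  exact Complex.norm_exp_ofReal_mul_I _

lemma ee_conj (a : QZ) : (starRingEnd ℂ) (ee a) = ee (-a) := by
  rw [ee_neg, Complex.inv_eq_conj (ee_norm a)]

lemma ee_nsmul (n : ℕ) (a : QZ) : ee (n • a) = ee a ^ n := by
  induction n with
  | zero => simp [ee_zero]
  | succ n ih => rw [succ_nsmul, ee_add, ih, pow_succ]

lemma ee_half {a : QZ} (h : 2 • a = 0) (h0 : a ≠ 0) : ee a = -1 := by
  have h1 : ee a ^ 2 = 1 := by rw [← ee_nsmul, h, ee_zero]
  rcases (sq_eq_sq_iff_eq_or_eq_neg.1 (h1.trans (one_pow 2).symm)) with h2 | h2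
  · exact absurd (ee_eq_one h2) h0
  · exact h2

lemma ee_quarter {a : QZ} (h : 4 • a = 0) (h0 : a ≠ 0) : (ee a).re ≤ 0 := by
  by_cases h2 : 2 • a = 0
  · rw [ee_half h2 h0]; simp
  · have h1 : ee (2 • a) = -1 := ee_half (by rw [← mul_nsmul]; exact h) h2
    rw [ee_nsmul] at h1
    have h3 : (ee a ^ 2).im = 0 := by rw [h1]; simp
    have h4 : (ee a ^ 2).re = -1 := by rw [h1]; simp
    simp [pow_two] at h3 h4
    have : (ee a).re * (ee a).im = 0 := by linarith
    rcases mul_eq_zero.1 this with h5 | h5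
    · exact h5.le
    · rw [h5] at h4; nlinarith

/-- divisibility in `ℚ/ℤ`. -/
lemma qz_mult {p r : ℕ} (hp : p.Prime) {t u : QZ} (ht : p ^ (r+1) • t = 0)
    (hu : p ^ (r+1) • u = 0) (hu' : p ^ r • u ≠ 0) : ∃ n : ℤ, t = n • u := by
  induction t using QuotientAddGroup.induction_on with | _ t =>
  induction u using QuotientAddGroup.induction_on with | _ u =>
  obtain ⟨a, ha⟩ := (AddCircle.coe_eq_zero_iff (1:ℚ) (x := p^(r+1) • t)).1 ht
  obtain ⟨b, hb⟩ := (AddCircle.coe_eq_zero_iff (1:ℚ) (x := p^(r+1) • u)).1 hu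
  have hp0 : (p:ℚ) ≠ 0 := by exact_mod_cast hp.ne_zero
  simp only [zsmul_eq_mul, mul_one, nsmul_eq_mul] at ha hb
  push_cast at ha hb
  have hpb : IsCoprime (p:ℤ) b := by
    rw [(Nat.prime_iff_prime_int.1 hp).irreducible.coprime_iff_not_dvd]
    rintro ⟨c, rfl⟩
    apply hu'
    refine (AddCircle.coe_eq_zero_iff (1:ℚ) (x := p^r • u)).2 ⟨c, ?_⟩
    simp only [zsmul_eq_mul, mul_one, nsmul_eq_mul]
    push_cast at hb ⊢
    rw [pow_succ] at hb
    apply mul_left_cancel₀ hp0; rw [hb]; ring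
  have hc : IsCoprime ((p:ℤ)^(r+1)) b := hpb.pow_left
  obtain ⟨x, y, hxy⟩ := hc
  refine ⟨a * y, ?_⟩
  have key : t - (a*y) * u = a * x := by
    have hpp : (p:ℚ)^(r+1) ≠ 0 := pow_ne_zero _ hp0
    apply mul_left_cancel₀ hpp
    have hxy' : (x:ℚ) * p^(r+1) + y * b = 1 := by exact_mod_cast hxy
    linear_combination (-ha) + a * y * hb - a * hxy'
  have : ((t - (a*y) * u : ℚ) : QZ) = 0 := by
    refine (AddCircle.coe_eq_zero_iff (1:ℚ)).2 ⟨a*x, ?_⟩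
    rw [key]; simp
  have h2 : ((t : ℚ) : QZ) - ((((a*y : ℤ)) • u : ℚ) : QZ) = 0 := by
    rw [← this, ← AddCircle.coe_sub]; simp
  exact sub_eq_zero.1 h2

variable {M : Type} [AddCommGroup M] 

lemma two_gen_card (p : ℕ) (hp : p.Prime) [Finite M]
    (hgen : ∃ a b : M, AddSubgroup.closure {a, b} = ⊤) (H : AddSubgroup M) :
    Nat.card (H.comap (nsmulAddMonoidHom p)) ≤ p ^ 2 * Nat.card H := by
  obtain ⟨a, b, hab⟩ := hgen
  let f : M →+ M ⧸ H := (QuotientAddGroup.mk' H).comp (nsmulAddMonoidHom p)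
  have hk : f.ker = H.comap (nsmulAddMonoidHom p) := by
    ext x; exact QuotientAddGroup.eq_zero_iff (N := H) (p • x)
  have h1 : Nat.card f.ker * Nat.card f.range = Nat.card M := by
    rw [← AddSubgroup.index_ker, AddSubgroup.card_mul_index]
  have h2 : Nat.card H * Nat.card (M ⧸ H) = Nat.card M := by
    exact AddSubgroup.card_mul_index H
  have h3 : Nat.card f.range * Nat.card ((M ⧸ H) ⧸ f.range) = Nat.card (M ⧸ H) :=
    AddSubgroup.card_mul_index _
  have h4 : Nat.card ((M ⧸ H) ⧸ f.range) ≤ p ^ 2 := by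
    let g : Fin p × Fin p → (M ⧸ H) ⧸ f.range := fun ij =>
      QuotientAddGroup.mk' f.range (QuotientAddGroup.mk' H ((ij.1 : ℕ) • a + (ij.2 : ℕ) • b))
    have hg : Function.Surjective g := by
      intro y
      obtain ⟨y, rfl⟩ := QuotientAddGroup.mk'_surjective _ y
      obtain ⟨y, rfl⟩ := QuotientAddGroup.mk'_surjective _ y
      have hy : y ∈ AddSubgroup.closure {a, b} := by rw [hab]; trivial
      obtain ⟨i, j, rfl⟩ := AddSubgroup.mem_closure_pair.1 hy
      have hp0 : (p:ℤ) ≠ 0 := by exact_mod_cast hp.ne_zero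
      have hpp : (0:ℤ) < p := by exact_mod_cast hp.pos
      have hred : ∀ i : ℤ, ∃ (n : Fin p) (c : ℤ), i = (n : ℕ) + p * c := fun i => by
        refine ⟨⟨(i % p).toNat, ?_⟩, i / p, ?_⟩
        · have := Int.emod_lt_of_pos i hpp; have := Int.emod_nonneg i hp0; omega
        · have := Int.emod_nonneg i hp0
          simp only [Int.toNat_of_nonneg this]
          exact (Int.emod_add_mul_ediv i p).symm
      obtain ⟨n, c, hn⟩ := hred i
      obtain ⟨n', c', hn'⟩ := hred j
      refine ⟨(n, n'), ?_⟩
      simp only [g]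
      rw [← sub_eq_zero, ← map_sub]
      refine (QuotientAddGroup.eq_zero_iff _).2 ⟨-(c • a + c' • b), ?_⟩
      simp only [f, AddMonoidHom.comp_apply]
      rw [← map_sub]; congr 1
      rw [hn, hn']
      simp only [nsmulAddMonoidHom_apply, add_smul, mul_smul, natCast_zsmul, smul_neg, smul_add]
      abel
    have := Nat.card_le_card_of_surjective g hg
    simpa [pow_two] using this
  rw [hk] at h1
  have hR : 0 < Nat.card f.range := Nat.card_pos
  have : Nat.card (H.comap (nsmulAddMonoidHom p)) * Nat.card f.range
      = (Nat.card ((M ⧸ H) ⧸ f.range) * Nat.card H) * Nat.card f.range := by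
    rw [h1, ← h2, ← h3]; ring
  have := Nat.eq_of_mul_eq_mul_right hR this
  rw [this]; gcongr

lemma card_lt_step {p k : ℕ} (hp : p.Prime) [Finite M] (hcard : Nat.card M = p ^ k)
    {A C : AddSubgroup M} (h : A ≤ C) {x : M} (hx : x ∈ C) (hxA : x ∉ A) :
    p * Nat.card A ≤ Nat.card C := by
  obtain ⟨i, -, hi⟩ := (Nat.dvd_prime_pow hp).1 (hcard ▸ AddSubgroup.card_addSubgroup_dvd_card A)
  obtain ⟨j, -, hj⟩ := (Nat.dvd_prime_pow hp).1 (hcard ▸ AddSubgroup.card_addSubgroup_dvd_card C)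
  have hlt : Nat.card A < Nat.card C := by
    apply lt_of_le_of_ne (AddSubgroup.card_le_of_le h)
    intro he
    have := AddSubgroup.eq_of_le_of_card_ge h he.ge
    exact hxA (this ▸ hx)
  rw [hi, hj] at *
  have := (Nat.pow_lt_pow_iff_right hp.one_lt).1 hlt
  rw [← pow_succ']
  exact Nat.pow_le_pow_right hp.pos this

end

section
open scoped Classical
variable {M : Type} [AddCommGroup M]

/-- orthogonal complement -/
def perpS (B : M →+ M →+ QZ) (H : AddSubgroup M) : AddSubgroup M where
  carrier := {x | ∀ h ∈ H, B x h = 0}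
  zero_mem' := by intro h _; simp
  add_mem' := by
    intro a b ha hb h hh
    simp [ha h hh, hb h hh]
  neg_mem' := by
    intro a ha h hh
    simp [ha h hh]

lemma mem_perpS {B : M →+ M →+ QZ} {H : AddSubgroup M} {x : M} :
    x ∈ perpS B H ↔ ∀ h ∈ H, B x h = 0 := Iff.rfl

lemma sum_mem_card [Fintype M] (H : AddSubgroup M) :
    (∑ x : M, if x ∈ H then (1:ℂ) else 0) = Nat.card H := by
  rw [Finset.sum_boole]
  congr 1
  rw [← Fintype.card_subtype, Nat.card_eq_fintype_card]

lemma orth [Fintype M] (H : AddSubgroup M) (φ : M →+ QZ) :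
    (∑ x : M, if x ∈ H then ee (-(φ x)) else 0) =
      if (∀ h ∈ H, φ h = 0) then (Nat.card H : ℂ) else 0 := by
  split_ifs with h
  · rw [← sum_mem_card]
    refine Finset.sum_congr rfl fun x _ => ?_
    split_ifs with hx
    · rw [h x hx]; simp [ee_zero]
    · rfl
  · push Not at h
    obtain ⟨h0, hh0, hne⟩ := h
    set S := (∑ x : M, if x ∈ H then ee (-(φ x)) else 0) with hS
    have : S = ee (-(φ h0)) * S := by
      conv_lhs => rw [hS, ← Equiv.sum_comp (Equiv.addRight h0)]
      rw [hS, Finset.mul_sum]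
      refine Finset.sum_congr rfl fun x _ => ?_
      change (if x + h0 ∈ H then ee (-(φ (x + h0))) else 0) = _
      by_cases hx : x ∈ H
      · rw [if_pos hx, if_pos (H.add_mem hx hh0), map_add, neg_add, ee_add, mul_comm]
      · rw [if_neg hx, if_neg, mul_zero]
        intro hc; exact hx (by simpa using H.sub_mem hc hh0)
    have h1 : (1 - ee (-(φ h0))) * S = 0 := by linear_combination this
    rcases mul_eq_zero.1 h1 with h2 | h2
    · exfalso; apply hne
      have := ee_eq_one (sub_eq_zero.1 h2).symm
      simpa using this
    · exact h2

lemma orth_top [Fintype M] (φ : M →+ QZ) :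
    (∑ x : M, ee (-(φ x))) = if φ = 0 then (Nat.card M : ℂ) else 0 := by
  have := orth (⊤ : AddSubgroup M) φ
  rw [AddSubgroup.card_top] at this
  simp only [AddSubgroup.mem_top, if_true, forall_const] at this
  rw [this]
  refine if_congr ?_ rfl rfl
  exact ⟨fun h => AddMonoidHom.ext h, fun h x => by simp [h]⟩

/-- hypotheses on the quadratic form -/
structure QHyp (Q : M → QZ) (B : M →+ M →+ QZ) : Prop where
  add : ∀ x y, Q (x + y) = Q x + Q y + B x y
  sm : ∀ (n : ℤ) x, Q (n • x) = (n ^ 2 : ℤ) • Q x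
  nd : ∀ x, (∀ y, B x y = 0) → x = 0

variable {Q : M → QZ} {B : M →+ M →+ QZ}

lemma QHyp.symm (h : QHyp Q B) (x y : M) : B x y = B y x := by
  have h1 := h.add x y
  have h2 := h.add y x
  rw [add_comm y x, h1, add_comm (Q y)] at h2
  exact add_left_cancel h2

lemma QHyp.zero (h : QHyp Q B) : Q 0 = 0 := by
  have := h.sm 0 0
  simpa using this

lemma QHyp.nsm (h : QHyp Q B) (n : ℕ) (x : M) : Q (n • x) = (n ^ 2) • Q x := by
  have := h.sm n x
  rw [natCast_zsmul] at this
  rw [this, ← natCast_zsmul]; push_cast; rfl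

lemma QHyp.diag (h : QHyp Q B) (x : M) : B x x = 2 • Q x := by
  have h1 := h.add x x
  have h2 := h.nsm 2 x
  rw [two_nsmul x] at h2
  rw [h2] at h1
  have : B x x = (2^2 : ℕ) • Q x - (Q x + Q x) := by rw [h1]; abel
  rw [this, ← two_nsmul, sub_eq_iff_eq_add, ← add_nsmul]; norm_num

lemma QHyp.iso_le (h : QHyp Q B) {H : AddSubgroup M} (hH : ∀ x ∈ H, Q x = 0) :
    H ≤ perpS B H := by
  intro x hx y hy
  have := h.add x y
  rw [hH _ hx, hH _ hy, hH _ (H.add_mem hx hy)] at this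
  simpa using this.symm

lemma QHyp.iso_sup (h : QHyp Q B) {H : AddSubgroup M} (hH : ∀ x ∈ H, Q x = 0)
    {y : M} (hy : y ∈ perpS B H) (hQ : Q y = 0) :
    ∀ x ∈ H ⊔ AddSubgroup.zmultiples y, Q x = 0 := by
  intro x hx
  obtain ⟨a, ha, b, hb, rfl⟩ := AddSubgroup.mem_sup.1 hx
  obtain ⟨n, rfl⟩ := AddSubgroup.mem_zmultiples_iff.1 hb
  rw [h.add, hH a ha, h.sm, hQ, map_zsmul, h.symm a y, hy a ha]; simp

lemma perpS_sup {H : AddSubgroup M} {x y : M} (hx : x ∈ perpS B H) (hxy : B x y = 0) :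
    x ∈ perpS B (H ⊔ AddSubgroup.zmultiples y) := by
  intro z hz
  obtain ⟨a, ha, b, hb, rfl⟩ := AddSubgroup.mem_sup.1 hz
  obtain ⟨n, rfl⟩ := AddSubgroup.mem_zmultiples_iff.1 hb
  rw [map_add, hx a ha, map_zsmul, hxy]; simp

lemma QHyp.card_perp (h : QHyp Q B) [Fintype M] (H : AddSubgroup M) :
    Nat.card H * Nat.card (perpS B H) = Nat.card M := by
  have h1 : (∑ x : M, ∑ y : M, if y ∈ H then ee (-(B x y)) else 0)
      = Nat.card H * Nat.card (perpS B H) := by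
    rw [← sum_mem_card (perpS B H), Finset.mul_sum]
    refine Finset.sum_congr rfl fun x _ => ?_
    rw [orth H (B x)]
    simp [mem_perpS]
  have h2 : (∑ x : M, ∑ y : M, if y ∈ H then ee (-(B x y)) else 0) = Nat.card M := by
    rw [Finset.sum_comm, Finset.sum_eq_single 0]
    · simp [ee_zero]
    · intro y _ hy
      by_cases hyH : y ∈ H
      · simp only [hyH, if_true]
        have := orth_top (B y)
        rw [if_neg] at this
        · rw [← this]
          exact Finset.sum_congr rfl fun x _ => by rw [h.symm]
        · intro h0
          exact hy (h.nd y fun z => by simp [h0])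
      · simp [hyH]
    · simp
  rw [h1] at h2
  exact_mod_cast h2

lemma QHyp.gauss_perp (h : QHyp Q B) [Fintype M] {H : AddSubgroup M} (hH : ∀ x ∈ H, Q x = 0) :
    (∑ x : M, ee (-(Q x))) = ∑ x : M, if x ∈ perpS B H then ee (-(Q x)) else 0 := by
  have hc : (Nat.card H : ℂ) ≠ 0 := by exact_mod_cast Nat.card_pos.ne'
  apply mul_left_cancel₀ hc
  have h1 : (∑ y : M, ∑ x : M, if y ∈ H then ee (-(Q (x + y))) else 0)
      = Nat.card H * ∑ x : M, ee (-(Q x)) := by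
    rw [← sum_mem_card H, Finset.sum_mul]
    refine Finset.sum_congr rfl fun y _ => ?_
    by_cases hy : y ∈ H
    · simp only [hy, if_true, one_mul]
      exact Equiv.sum_comp (Equiv.addRight y) (fun x => ee (-(Q x)))
    · simp [hy]
  rw [← h1, Finset.sum_comm, Finset.mul_sum]
  refine Finset.sum_congr rfl fun x _ => ?_
  have h2 : (∑ y : M, if y ∈ H then ee (-(Q (x + y))) else 0)
      = ee (-(Q x)) * ∑ y : M, if y ∈ H then ee (-(B x y)) else 0 := by
    rw [Finset.mul_sum]
    refine Finset.sum_congr rfl fun y _ => ?_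
    split_ifs with hy
    · rw [h.add, hH y hy, ← ee_add]; congr 1; abel
    · simp
  rw [h2, orth H (B x)]
  simp only [mem_perpS]
  split_ifs <;> ring

lemma QHyp.gauss_norm (h : QHyp Q B) [Fintype M] :
    ‖∑ x : M, ee (-(Q x))‖ ^ 2 = Nat.card M := by
  have key : (∑ x : M, ee (-(Q x))) * (starRingEnd ℂ) (∑ x : M, ee (-(Q x))) = Nat.card M := by
    rw [map_sum, Finset.mul_sum]
    have : ∀ y : M, (∑ x : M, ee (-(Q x))) * (starRingEnd ℂ) (ee (-(Q y)))
        = ∑ z : M, ee (-(Q z)) * ee (-(B z y)) := by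
      intro y
      rw [← Equiv.sum_comp (Equiv.addRight y), Finset.sum_mul]
      refine Finset.sum_congr rfl fun z _ => ?_
      rw [ee_conj, ← ee_add, ← ee_add]
      simp only [Equiv.coe_addRight]
      rw [h.add]; congr 1; abel
    simp only [this]
    rw [Finset.sum_comm, Finset.sum_eq_single 0]
    · simp [h.zero, ee_zero]
    · intro z _ hz
      rw [← Finset.mul_sum, orth_top (B z), if_neg, mul_zero]
      intro h0
      exact hz (h.nd z fun y => by simp [h0])
    · simp
  rw [Complex.mul_conj, Complex.normSq_eq_norm_sq] at key
  exact_mod_cast key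

/-- A self-dual isotropic subgroup gives square order and Gauss sum. -/
lemma QHyp.lagr (h : QHyp Q B) [Fintype M] {H : AddSubgroup M} (hH : ∀ x ∈ H, Q x = 0)
    (hp : perpS B H = H) : Nat.card M = Nat.card H ^ 2 ∧ (∑ x : M, ee (-(Q x))) = Nat.card H := by
  constructor
  · rw [← h.card_perp H, hp, pow_two]
  · rw [h.gauss_perp hH, hp, ← sum_mem_card]
    refine Finset.sum_congr rfl fun x _ => ?_
    split_ifs with hx
    · rw [hH x hx]; simp [ee_zero]
    · rfl

/-- Forward direction: an invariant gives a self-dual isotropic subgroup. -/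
lemma QHyp.exists_lagr (h : QHyp Q B) [Fintype M] {p k : ℕ} (hp : p.Prime)
    (hcard : Nat.card M = p ^ k) (hgen : ∃ a b : M, AddSubgroup.closure {a, b} = ⊤)
    (lam : M → ℂ) (h0 : lam ≠ 0) (hT : ∀ x, lam x ≠ 0 → Q x = 0) (c : ℂ)
    (hS : ∀ y, lam y = c * ∑ x, ee (-(B y x)) * lam x) :
    ∃ H : AddSubgroup M, (∀ x ∈ H, Q x = 0) ∧ perpS B H = H := by
  have hpk : ∀ x : M, p ^ k • x = 0 := fun x => by rw [← hcard]; exact card_nsmul_eq_zero'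
  let P : AddSubgroup M → Prop := fun H => (∀ x ∈ H, Q x = 0) ∧ ∀ x, lam x ≠ 0 → x ∈ perpS B H
  have hex : ∃ H, Maximal P H := by
    apply Set.Finite.exists_maximal (s := {H | P H}) (Set.toFinite _)
    refine ⟨⊥, ?_, ?_⟩
    · intro x hx; rw [AddSubgroup.mem_bot.1 hx]; exact h.zero
    · intro x _ y hy; rw [AddSubgroup.mem_bot.1 hy]; simp
  obtain ⟨H, ⟨hH, hsup⟩, hmax⟩ := hex
  have hle := h.iso_le hH
  have hR : ∃ R : ℕ, ∀ y ∈ perpS B H, Q y = 0 → p ^ R • y ∈ H :=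
    ⟨k, fun y _ _ => by rw [hpk]; exact H.zero_mem⟩
  rcases hRe : Nat.find hR with _ | r
  · have hspec := Nat.find_spec hR
    rw [hRe] at hspec
    simp only [pow_zero, one_smul] at hspec
    refine ⟨H, hH, le_antisymm ?_ hle⟩
    have hsH : ∀ x, lam x ≠ 0 → x ∈ H := fun x hx => hspec x (hsup x hx) (hT x hx)
    have hconst : ∀ y ∈ perpS B H, lam y = lam 0 := by
      intro y hy
      rw [hS y, hS 0]
      congr 1
      refine Finset.sum_congr rfl fun x _ => ?_
      by_cases hx : lam x = 0
      · simp [hx]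
      · rw [hy x (hsH x hx)]; simp
    have h00 : lam 0 ≠ 0 := by
      intro hz
      apply h0; funext x
      by_contra hx
      exact hx ((hconst x (hsup x hx)).trans hz)
    intro y hy
    exact hsH y (by rw [hconst y hy]; exact h00)
  · have hspec := Nat.find_spec hR
    rw [hRe] at hspec
    have hmin := Nat.find_min hR (m := r) (by omega)
    push Not at hmin
    obtain ⟨y, hy, hQy, hyr⟩ := hmin
    have hQh : Q (p ^ r • y) = 0 := by rw [h.nsm, hQy, smul_zero]
    have hhp : p ^ r • y ∈ perpS B H := AddSubgroup.nsmul_mem _ hy _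
    have hz : ∃ z, lam z ≠ 0 ∧ B z (p ^ r • y) ≠ 0 := by
      by_contra hcon
      push Not at hcon
      have hP : P (H ⊔ AddSubgroup.zmultiples (p ^ r • y)) :=
        ⟨h.iso_sup hH hhp hQh, fun x hx => perpS_sup (hsup x hx) (hcon x hx)⟩
      exact hyr (hmax hP le_sup_left
        (AddSubgroup.mem_sup_right (AddSubgroup.mem_zmultiples _)))
    obtain ⟨z, hlz, hzy⟩ := hz
    have hzp := hsup z hlz
    have hQz := hT z hlz
    have hu : p ^ (r+1) • B y z = 0 := by
      rw [← map_nsmul]; exact hy _ (hspec z hzp hQz)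
    have hu' : p ^ r • B y z ≠ 0 := by
      rw [h.symm y z, ← map_nsmul]; exact hzy
    have hyy : B y y = 0 := by rw [h.diag, hQy, smul_zero]
    have hiso := h.iso_sup hH hy hQy
    refine ⟨H ⊔ AddSubgroup.zmultiples y, hiso, le_antisymm ?_ (h.iso_le hiso)⟩
    intro w hw
    have hwH : w ∈ perpS B H := fun a ha => hw a (AddSubgroup.mem_sup_left ha)
    have hwy : B w y = 0 := hw y (AddSubgroup.mem_sup_right (AddSubgroup.mem_zmultiples _))
    have ht : p ^ (r+1) • B w z = 0 := by
      rw [← map_nsmul]; exact hwH _ (hspec z hzp hQz)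
    obtain ⟨n, hn⟩ := qz_mult hp ht hu hu'
    suffices hw' : w - n • y ∈ H by
      rw [← sub_add_cancel w (n • y)]
      exact AddSubgroup.add_mem _ (AddSubgroup.mem_sup_left hw')
        (AddSubgroup.mem_sup_right (AddSubgroup.mem_zmultiples_iff.2 ⟨n, rfl⟩))
    set w' := w - n • y with hw'def
    have hw'H : w' ∈ perpS B H := AddSubgroup.sub_mem _ hwH (AddSubgroup.zsmul_mem _ hy _)
    have hw'y : B w' y = 0 := by simp [hw'def, hwy, hyy]
    have hw'z : B w' z = 0 := by simp [hw'def, hn]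
    by_contra hnot
    have hJ : ∃ j : ℕ, p ^ j • w' ∈ H := ⟨k, by rw [hpk]; exact H.zero_mem⟩
    rcases hJe : Nat.find hJ with _ | j
    · have := Nat.find_spec hJ
      rw [hJe] at this
      exact hnot (by simpa using this)
    have hj1 := Nat.find_spec hJ
    rw [hJe] at hj1
    have hj2 := Nat.find_min hJ (m := j) (by omega)
    set v := p ^ j • w' with hv
    have hvy : B v y = 0 := by simp [hv, hw'y]
    have hvz : B v z = 0 := by simp [hv, hw'z]
    set K := H.comap (nsmulAddMonoidHom p) with hK
    have hvK : v ∈ K := by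
      change p • v ∈ H
      rw [hv, ← mul_nsmul', ← pow_succ']; exact hj1
    have hyK : p ^ r • y ∈ K := by
      change p • p ^ r • y ∈ H
      rw [← mul_nsmul', ← pow_succ']; exact hspec y hy hQy
    have hzK : p ^ r • z ∈ K := by
      change p • p ^ r • z ∈ H
      rw [← mul_nsmul', ← pow_succ']; exact hspec z hzp hQz
    have hHK : H ≤ K := fun x hx => H.nsmul_mem hx p
    set A1 := H ⊔ AddSubgroup.zmultiples v with hA1
    set A2 := A1 ⊔ AddSubgroup.zmultiples (p ^ r • y) with hA2
    set A3 := A2 ⊔ AddSubgroup.zmultiples (p ^ r • z) with hA3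
    have s1 : p * Nat.card H ≤ Nat.card A1 := card_lt_step hp hcard le_sup_left
      (AddSubgroup.mem_sup_right (AddSubgroup.mem_zmultiples v)) hj2
    have hzA1 : z ∈ perpS B A1 := perpS_sup hzp (by rw [h.symm]; exact hvz)
    have s2 : p * Nat.card A1 ≤ Nat.card A2 := card_lt_step hp hcard le_sup_left
      (AddSubgroup.mem_sup_right (AddSubgroup.mem_zmultiples _)) (fun hm => hzy (hzA1 _ hm))
    have hyA2 : y ∈ perpS B A2 := perpS_sup (perpS_sup hy (by rw [h.symm]; exact hvy))
      (by rw [map_nsmul, hyy, smul_zero])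
    have s3 : p * Nat.card A2 ≤ Nat.card A3 := card_lt_step hp hcard le_sup_left
      (AddSubgroup.mem_sup_right (AddSubgroup.mem_zmultiples _))
      (fun hm => hu' (by rw [← map_nsmul]; exact hyA2 _ hm))
    have s4 : Nat.card A3 ≤ Nat.card K := by
      apply AddSubgroup.card_le_of_le
      refine sup_le (sup_le (sup_le hHK ?_) ?_) ?_ <;>
        simpa [AddSubgroup.zmultiples_le] using by assumption
    have s5 := two_gen_card p hp hgen H
    have hc : 0 < Nat.card H := Nat.card_pos
    have h2 := hp.two_le
    have e1 : p * (p * (p * Nat.card H)) ≤ p ^ 2 * Nat.card H := by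
      calc p * (p * (p * Nat.card H)) ≤ p * (p * Nat.card A1) := by gcongr
        _ ≤ p * Nat.card A2 := by gcongr
        _ ≤ _ := s3.trans (s4.trans s5)
    have e2 : 0 < p ^ 2 * Nat.card H := by positivity
    nlinarith

end

section
open scoped Classical
variable {M : Type} [AddCommGroup M] {Q : M → QZ} {B : M →+ M →+ QZ}

lemma ee_re_le (a : QZ) : (ee a).re ≤ 1 := by
  have := Complex.re_le_norm (ee a)
  rwa [ee_norm] at this

lemma ee_re_lt {a : QZ} (ha : a ≠ 0) : (ee a).re < 1 := by
  refine lt_of_le_of_ne (ee_re_le a) fun h => ha (ee_eq_one ?_)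
  have h1 := Complex.normSq_eq_norm_sq (ee a)
  rw [ee_norm, Complex.normSq_apply, h] at h1
  apply Complex.ext
  · simpa using h
  · have : (ee a).im * (ee a).im = 0 := by linarith
    simpa using this

lemma odd_tor {p l : ℕ} (hp : p.Prime) (h2 : p ≠ 2) {t : QZ} (h : 2 • t = 0)
    (h' : p ^ l • t = 0) : t = 0 := by
  have hd1 := addOrderOf_dvd_of_nsmul_eq_zero h
  have hd2 := addOrderOf_dvd_of_nsmul_eq_zero h'
  have hc : Nat.Coprime 2 (p ^ l) :=
    Nat.Coprime.pow_right _ ((Nat.coprime_primes Nat.prime_two hp).2 h2.symm)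
  have := Nat.eq_one_of_dvd_coprimes hc hd1 hd2
  exact AddMonoid.addOrderOf_eq_one_iff.1 this

lemma perp_step {p s k : ℕ} {P H : AddSubgroup M} (hpk : ∀ x : M, p ^ k • x = 0)
    (hst : ∀ x ∈ P, p ^ (s + 1) • x ∈ H → p ^ s • x ∈ H) : ∀ x ∈ P, p ^ s • x ∈ H := by
  have key : ∀ n : ℕ, ∀ x ∈ P, p ^ (s + n) • x ∈ H → p ^ s • x ∈ H := by
    intro n
    induction n with
    | zero => intro x _ hx; exact hx
    | succ n ih =>
      intro x hx hxn
      apply ih x hx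
      have := hst (p ^ n • x) (P.nsmul_mem hx _) (by
        rw [← mul_nsmul', ← pow_add]
        rwa [show s + 1 + n = s + (n + 1) by ring])
      rwa [← mul_nsmul', ← pow_add] at this
  intro x hx
  apply key k x hx
  rw [pow_add, mul_nsmul', hpk, smul_zero]; exact H.zero_mem

lemma QHyp.scale (h : QHyp Q B) {p k : ℕ} (hpk : ∀ x : M, p ^ k • x = 0) {c : ℕ}
    (hc : Nat.Coprime c p) : QHyp (fun x => c • Q x) (c • B) where
  add x y := by simp [h.add x y]
  sm n x := by
    rw [h.sm n x, smul_comm]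
  nd x hx := by
    have h1 : c • x = 0 := h.nd _ fun y => by
      have := hx y
      simpa using this
    have hd1 := addOrderOf_dvd_of_nsmul_eq_zero h1
    have hd2 := addOrderOf_dvd_of_nsmul_eq_zero (hpk x)
    exact AddMonoid.addOrderOf_eq_one_iff.1
      (Nat.eq_one_of_dvd_coprimes (Nat.Coprime.pow_right k hc) hd1 hd2)

lemma sum_mem_re [Fintype M] (P : AddSubgroup M) (f : M → ℂ) :
    (∑ x : M, if x ∈ P then f x else 0).re = ∑ x : M, if x ∈ P then (f x).re else 0 := by
  rw [Complex.re_sum]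
  exact Finset.sum_congr rfl fun x _ => by split_ifs <;> simp

lemma sum_mem_card_re [Fintype M] (H : AddSubgroup M) :
    (∑ x : M, if x ∈ H then (1:ℝ) else 0) = Nat.card H := by
  have := congrArg Complex.re (sum_mem_card H)
  rw [sum_mem_re] at this
  simpa using this

lemma QHyp.back_odd (h : QHyp Q B) [Fintype M] {p k m : ℕ} (hp : p.Prime) (h2 : p ≠ 2)
    (hcard : Nat.card M = p ^ k) (hgen : ∃ a b : M, AddSubgroup.closure {a, b} = ⊤)
    (hm : Nat.card M = m ^ 2) (hG : (∑ x : M, ee (-(Q x))) = m)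
    {H : AddSubgroup M} (hH : ∀ x ∈ H, Q x = 0) (han : ∀ x ∈ perpS B H, Q x = 0 → x ∈ H)
    (hmH : p * Nat.card H ≤ m) : False := by
  have hpk : ∀ x : M, p ^ k • x = 0 := fun x => by rw [← hcard]; exact card_nsmul_eq_zero'
  have hle := h.iso_le hH
  have htor : ∀ x, p ^ (k * 2) • Q x = 0 := fun x => by
    rw [pow_mul, ← h.nsm, hpk, h.zero]
  have hpx : ∀ x ∈ perpS B H, p • x ∈ H := by
    have := perp_step (p := p) (s := 1) (k := k) (P := perpS B H) (H := H) hpk (by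
      intro x hx hx2
      apply han _ (AddSubgroup.nsmul_mem _ hx _)
      rw [h.nsm]
      refine odd_tor (l := k * 2) hp h2 ?_ ?_
      · rw [smul_comm, ← h.diag, pow_one, ← map_nsmul]
        exact hx _ hx2
      · rw [smul_comm, htor, smul_zero])
    simpa using this
  have hpQ : ∀ x ∈ perpS B H, p • Q x = 0 := by
    intro x hx
    refine odd_tor (l := k * 2) hp h2 ?_ ?_
    · rw [smul_comm, ← h.diag, ← map_nsmul]
      exact hx _ (hpx x hx)
    · rw [smul_comm, htor, smul_zero]
  have hcp := h.card_perp H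
  have hPK : Nat.card (perpS B H) ≤ p ^ 2 * Nat.card H :=
    (AddSubgroup.card_le_of_le (fun x hx => hpx x hx)).trans (two_gen_card p hp hgen H)
  have hcH : 0 < Nat.card H := Nat.card_pos
  have hmle : m = p * Nat.card H := by
    refine le_antisymm ?_ hmH
    have e : m ^ 2 ≤ (p * Nat.card H) ^ 2 := by
      rw [← hm, ← hcp, mul_pow, pow_two (Nat.card H)]
      calc _ ≤ Nat.card H * (p ^ 2 * Nat.card H) := by gcongr
        _ = _ := by ring
    exact (Nat.pow_le_pow_iff_left (by norm_num)).1 e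
  have hPc : Nat.card (perpS B H) = p * m := by
    apply Nat.eq_of_mul_eq_mul_left hcH
    rw [hcp, hm, hmle]; ring
  have hm0 : 0 < m := by rw [hmle]; exact Nat.mul_pos hp.pos hcH
  let F : ℕ → ℂ := fun c => ∑ x : M, if x ∈ perpS B H then ee (-(c • Q x)) else 0
  have hF0 : F 0 = p * m := by
    simp only [F, zero_smul, neg_zero, ee_zero]
    rw [sum_mem_card, hPc]; push_cast; rfl
  have hF1 : F 1 = m := by
    simp only [F, one_smul]
    rw [← h.gauss_perp hH, hG]
  have hFc : ∀ c, Nat.Coprime c p → -(m:ℝ) ≤ (F c).re := by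
    intro c hc
    have hs := h.scale hpk hc
    have h1 := hs.gauss_norm
    have h3 := hs.gauss_perp (H := H) (fun x hx => by simp [hH x hx])
    have h4 : perpS (c • B) H = perpS B H := by
      apply le_antisymm
      · intro x hx y hy
        have h5 : c • B x y = 0 := hx y hy
        have h6 : p ^ k • B x y = 0 := by rw [← map_nsmul, hpk, map_zero]
        exact AddMonoid.addOrderOf_eq_one_iff.1
          (Nat.eq_one_of_dvd_coprimes (Nat.Coprime.pow_right k hc)
            (addOrderOf_dvd_of_nsmul_eq_zero h5) (addOrderOf_dvd_of_nsmul_eq_zero h6))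
      · intro x hx y hy
        change c • B x y = 0
        rw [hx y hy, smul_zero]
    rw [h4] at h3
    have h7 : ‖F c‖ ^ 2 = (m:ℝ) ^ 2 := by
      change ‖∑ x : M, if x ∈ perpS B H then ee (-(c • Q x)) else 0‖ ^ 2 = _
      rw [← h3, h1, hm]; push_cast; rfl
    have h8 : ‖F c‖ = m := by
      exact (sq_eq_sq₀ (norm_nonneg _) (Nat.cast_nonneg m)).1 h7
    have := Complex.abs_re_le_norm (F c)
    rw [h8] at this
    exact (abs_le.1 this).1
  have hsum : ∑ c ∈ Finset.range p, F c = m := by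
    simp only [F]
    rw [Finset.sum_comm]
    have : ((m:ℕ):ℂ) = p * ∑ x : M, if x ∈ H then (1:ℂ) else 0 := by
      rw [sum_mem_card, hmle]; push_cast; rfl
    rw [this, Finset.mul_sum]
    refine Finset.sum_congr rfl fun x _ => ?_
    by_cases hx : x ∈ perpS B H
    · simp only [hx, if_true]
      by_cases hxH : x ∈ H
      · simp [hxH, hH x hxH, ee_zero]
      · simp only [hxH, if_false, mul_zero]
        have hz : ee (-(Q x)) ≠ 1 := fun hc => hxH (han x hx (by simpa using ee_eq_one hc))
        have hzp : ee (-(Q x)) ^ p = 1 := by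
          rw [← ee_nsmul, smul_neg, hpQ x hx, neg_zero, ee_zero]
        have : ∀ c : ℕ, ee (-(c • Q x)) = ee (-(Q x)) ^ c := fun c => by
          rw [← ee_nsmul, smul_neg]
        simp only [this]
        rw [geom_sum_eq hz, hzp]; simp
    · have : x ∉ H := fun hc => hx (hle hc)
      simp [hx, this]
  obtain ⟨q, rfl⟩ : ∃ q, p = q + 2 := ⟨p - 2, by have := hp.two_le; omega⟩
  rw [Finset.sum_range_succ', Finset.sum_range_succ'] at hsum
  simp only [zero_add] at hsum
  rw [hF0, hF1] at hsum
  have hre := congrArg Complex.re hsum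
  simp only [Complex.add_re, Complex.re_sum] at hre
  have hlow : ∑ c ∈ Finset.range q, (-(m:ℝ)) ≤ ∑ c ∈ Finset.range q, (F (c + 1 + 1)).re := by
    refine Finset.sum_le_sum fun c hc => hFc _ ?_
    have := Finset.mem_range.1 hc
    exact ((hp.coprime_iff_not_dvd).2 fun hd => by
      have := Nat.le_of_dvd (by omega) hd
      omega).symm
  rw [Finset.sum_const, Finset.card_range, nsmul_eq_mul] at hlow
  have e : (((q + 2 : ℕ) : ℂ) * (m:ℂ)).re = (q + 2) * m := by
    rw [← Nat.cast_mul, Complex.natCast_re]; push_cast; ring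
  rw [e, Complex.natCast_re] at hre
  have : (0:ℝ) < m := by exact_mod_cast hm0
  nlinarith

lemma QHyp.back_two (h : QHyp Q B) [Fintype M] {k m : ℕ}
    (hcard : Nat.card M = 2 ^ k) (hgen : ∃ a b : M, AddSubgroup.closure {a, b} = ⊤)
    (hm : Nat.card M = m ^ 2) (hG : (∑ x : M, ee (-(Q x))) = m)
    {H : AddSubgroup M} (hH : ∀ x ∈ H, Q x = 0) (han : ∀ x ∈ perpS B H, Q x = 0 → x ∈ H)
    (hmH : 2 * Nat.card H ≤ m) : False := by
  have hp := Nat.prime_two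
  have hpk : ∀ x : M, 2 ^ k • x = 0 := fun x => by rw [← hcard]; exact card_nsmul_eq_zero'
  have hle := h.iso_le hH
  have h4x : ∀ x ∈ perpS B H, 4 • x ∈ H := by
    refine perp_step (p := 2) (s := 2) (k := k) (P := perpS B H) (H := H) hpk (by
      intro x hx hx2
      apply han _ (AddSubgroup.nsmul_mem _ hx _)
      rw [h.nsm]
      have := hx _ hx2
      rw [map_nsmul, h.diag, ← mul_nsmul'] at this
      exact this)
  have hcp := h.card_perp H
  have hcH : 0 < Nat.card H := Nat.card_pos
  have hGp := hG
  rw [h.gauss_perp hH] at hGp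
  by_cases hcase : ∀ x ∈ perpS B H, 2 • x ∈ H
  · have hre := congrArg Complex.re hGp
    rw [sum_mem_re, Complex.natCast_re] at hre
    have : (m:ℝ) ≤ Nat.card H := by
      rw [← hre, ← sum_mem_card_re]
      refine Finset.sum_le_sum fun x _ => ?_
      by_cases hx : x ∈ perpS B H
      · rw [if_pos hx]
        split_ifs with hxH
        · exact ee_re_le _
        · apply ee_quarter
          · have := hx _ (hcase x hx)
            rw [map_nsmul, h.diag, ← mul_nsmul'] at this
            rw [smul_neg, neg_eq_zero]; exact this
          · intro hc; exact hxH (han x hx (by simpa using hc))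
      · have : x ∉ H := fun hc => hx (hle hc)
        simp [hx, this]
    have : m ≤ Nat.card H := by exact_mod_cast this
    omega
  · push Not at hcase
    obtain ⟨x, hx, hx2⟩ := hcase
    have hhalf : ∀ y ∈ perpS B H, 2 • y ∉ H → ee (-(Q (2 • y))) = -1 := by
      intro y hy hy2
      apply ee_half
      · have := hy _ (h4x y hy)
        rw [map_nsmul, h.diag, ← mul_nsmul'] at this
        rw [smul_neg, neg_eq_zero, h.nsm, ← mul_nsmul']; exact this
      · intro hc
        exact hy2 (han _ (AddSubgroup.nsmul_mem _ hy _) (by simpa using hc))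
    have hcross : ∀ y ∈ perpS B H, ∀ z ∈ perpS B H, B (2 • y) (2 • z) = 0 := by
      intro y hy z hz
      have := hy _ (h4x z hz)
      rw [map_nsmul] at this
      rw [map_nsmul, map_nsmul, AddMonoidHom.nsmul_apply, ← mul_nsmul']; exact this
    set K := H.comap (nsmulAddMonoidHom 2) ⊓ perpS B H with hK
    have hKm : ∀ z, z ∈ K ↔ 2 • z ∈ H ∧ z ∈ perpS B H := fun z => Iff.rfl
    have hdiff : ∀ y ∈ perpS B H, 2 • y ∉ H → 2 • (y - x) ∈ H := by
      intro y hy hy2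
      apply han _ (AddSubgroup.nsmul_mem _ (AddSubgroup.sub_mem _ hy hx) _)
      have e1 : 2 • (y - x) = 2 • y + (-1 : ℤ) • (2 • x) := by
        simp [smul_sub, sub_eq_add_neg]
      have e2 : Q (2 • (y - x)) = Q (2 • y) + Q (2 • x) := by
        rw [e1, h.add, h.sm, map_zsmul, hcross y hy x hx]; simp
      have e3 : ee (-(Q (2 • (y - x)))) = 1 := by
        rw [e2, neg_add, ee_add, hhalf y hy hy2, hhalf x hx hx2]; norm_num
      simpa using ee_eq_one e3
    have hS1 : (∑ z : M, if z ∈ K then ee (-(Q z)) else 0) = 0 := by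
      have h2K : 2 • x ∈ K := (hKm _).2 ⟨by
        rw [← mul_nsmul']; exact h4x x hx, AddSubgroup.nsmul_mem _ hx _⟩
      set S := (∑ z : M, if z ∈ K then ee (-(Q z)) else 0) with hS
      have : S = - S := by
        conv_lhs => rw [hS, ← Equiv.sum_comp (Equiv.addRight (2 • x))]
        rw [hS, ← Finset.sum_neg_distrib]
        refine Finset.sum_congr rfl fun z _ => ?_
        change (if z + 2 • x ∈ K then ee (-(Q (z + 2 • x))) else 0) = _
        by_cases hz : z ∈ K
        · rw [if_pos hz, if_pos (K.add_mem hz h2K), h.add]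
          have hb : B z (2 • x) = 0 := by
            have := hx _ ((hKm z).1 hz).1
            rw [map_nsmul, h.symm, ← map_nsmul] at this
            exact this
          rw [hb, add_zero, neg_add, ee_add, hhalf x hx hx2]; ring
        · rw [if_neg hz, if_neg, neg_zero]
          intro hc; exact hz (by simpa using K.sub_mem hc h2K)
      have h3 : (2:ℂ) * S = 0 := by linear_combination this
      simpa using h3
    have hS2 : (m:ℂ) = ∑ z : M, if z ∈ K then ee (-(Q (z + x))) else 0 := by
      have e0 : (m:ℂ) = (∑ z : M, if z ∈ perpS B H then ee (-(Q z)) else 0)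
          - (∑ z : M, if z ∈ K then ee (-(Q z)) else 0) := by rw [hS1, hGp, sub_zero]
      rw [e0, ← Finset.sum_sub_distrib, ← Equiv.sum_comp (Equiv.addRight x)]
      refine Finset.sum_congr rfl fun z _ => ?_
      change (if z + x ∈ perpS B H then ee (-(Q (z + x))) else 0)
        - (if z + x ∈ K then ee (-(Q (z + x))) else 0) = _
      by_cases hz : z ∈ perpS B H
      · rw [if_pos (AddSubgroup.add_mem _ hz hx)]
        by_cases hzK : z ∈ K
        · rw [if_pos hzK, if_neg, sub_zero]
          intro hc
          have h5 := K.sub_mem hc hzK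
          rw [add_sub_cancel_left] at h5
          exact hx2 ((hKm x).1 h5).1
        · rw [if_neg hzK, if_pos, sub_self]
          refine (hKm _).2 ⟨?_, AddSubgroup.add_mem _ hz hx⟩
          by_contra hc
          have := hdiff (z + x) (AddSubgroup.add_mem _ hz hx) hc
          rw [add_sub_cancel_right] at this
          exact hzK ((hKm z).2 ⟨this, hz⟩)
      · have h5 : z ∉ K := fun hc => hz ((hKm z).1 hc).2
        have h6 : z + x ∉ perpS B H := fun hc => hz (by simpa using AddSubgroup.sub_mem _ hc hx)
        have h7 : z + x ∉ K := fun hc => h6 ((hKm _).1 hc).2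
        simp [h5, h6, h7]
    have hQx : Q x ≠ 0 := fun hc => by
      apply hx2
      apply han _ (AddSubgroup.nsmul_mem _ hx _)
      rw [h.nsm, hc, smul_zero]
    have hre := congrArg Complex.re hS2
    rw [sum_mem_re, Complex.natCast_re] at hre
    have hlt : (m:ℝ) < Nat.card K := by
      rw [hre, ← sum_mem_card_re]
      refine Finset.sum_lt_sum (fun z _ => ?_) ⟨0, Finset.mem_univ _, ?_⟩
      · split_ifs
        · exact ee_re_le _
        · exact le_rfl
      · rw [if_pos K.zero_mem, if_pos K.zero_mem, zero_add]
        exact ee_re_lt (by simpa using hQx)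
    have hlt' : m < Nat.card K := by exact_mod_cast hlt
    have hK4 : Nat.card K ≤ 2 ^ 2 * Nat.card H :=
      (AddSubgroup.card_le_of_le inf_le_left).trans (two_gen_card 2 hp hgen H)
    have hK2 : 2 * Nat.card K ≤ Nat.card (perpS B H) :=
      card_lt_step hp hcard inf_le_right hx (fun hc => hx2 ((hKm x).1 hc).1)
    obtain ⟨i, -, hi⟩ := (Nat.dvd_prime_pow hp).1
      (hcard ▸ AddSubgroup.card_addSubgroup_dvd_card H)
    obtain ⟨j, -, hj⟩ := (Nat.dvd_prime_pow hp).1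
      (show m ∣ 2 ^ k by rw [← hcard, hm]; exact Dvd.intro_left (m ^ 1) (by ring))
    have hm2 : m ≤ 2 * Nat.card H := by
      have : 2 ^ j < 2 ^ (i + 2) := by
        rw [← hj, pow_add, ← hi]; omega
      have := (Nat.pow_lt_pow_iff_right (by norm_num)).1 this
      rw [hi, hj, ← pow_succ']
      exact Nat.pow_le_pow_right (by norm_num) (by omega)
    have hme : m = 2 * Nat.card H := le_antisymm hm2 hmH
    have : Nat.card (perpS B H) = 4 * Nat.card H := by
      apply Nat.eq_of_mul_eq_mul_left hcH
      rw [hcp, hm, hme]; ring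
    omega

lemma QHyp.back (h : QHyp Q B) [Fintype M] {p k m : ℕ} (hp : p.Prime)
    (hcard : Nat.card M = p ^ k) (hgen : ∃ a b : M, AddSubgroup.closure {a, b} = ⊤)
    (hm : Nat.card M = m ^ 2) (hG : (∑ x : M, ee (-(Q x))) = m) :
    ∃ H : AddSubgroup M, (∀ x ∈ H, Q x = 0) ∧ perpS B H = H := by
  have hex : ∃ H, Maximal (fun H : AddSubgroup M => ∀ x ∈ H, Q x = 0) H := by
    apply Set.Finite.exists_maximal (s := {H : AddSubgroup M | ∀ x ∈ H, Q x = 0}) (Set.toFinite _)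
    refine ⟨⊥, ?_⟩
    intro x hx; rw [AddSubgroup.mem_bot.1 hx]; exact h.zero
  obtain ⟨H, hH, hmax⟩ := hex
  have hle := h.iso_le hH
  have han : ∀ x ∈ perpS B H, Q x = 0 → x ∈ H := fun x hx hQ =>
    hmax (h.iso_sup hH hx hQ) le_sup_left
      (AddSubgroup.mem_sup_right (AddSubgroup.mem_zmultiples _))
  refine ⟨H, hH, ?_⟩
  by_contra hne
  obtain ⟨x, hx, hxH⟩ := SetLike.exists_of_lt (lt_of_le_of_ne hle (Ne.symm hne))
  have hst := card_lt_step hp hcard hle hx hxH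
  have hcp := h.card_perp H
  have hcH : 0 < Nat.card H := Nat.card_pos
  obtain ⟨i, -, hi⟩ := (Nat.dvd_prime_pow hp).1
    (hcard ▸ AddSubgroup.card_addSubgroup_dvd_card H)
  obtain ⟨j, -, hj⟩ := (Nat.dvd_prime_pow hp).1
    (show m ∣ p ^ k by rw [← hcard, hm]; exact Dvd.intro_left (m ^ 1) (by ring))
  have h2 := hp.two_le
  have hlt : Nat.card H < m := by
    by_contra hc
    push Not at hc
    have : m ^ 2 ≤ Nat.card H * Nat.card H := by rw [pow_two]; gcongr
    rw [← hm, ← hcp] at this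
    have := Nat.le_of_mul_le_mul_left this hcH
    nlinarith
  have hmH : p * Nat.card H ≤ m := by
    rw [hi, hj] at hlt
    have := (Nat.pow_lt_pow_iff_right hp.one_lt).1 hlt
    rw [hi, hj, ← pow_succ']
    exact Nat.pow_le_pow_right hp.pos this
  by_cases h2 : p = 2
  · subst h2
    exact h.back_two hcard hgen hm hG hH han hmH
  · exact h.back_odd hp h2 hcard hgen hm hG hH han hmH

end

/-- for a nondegenerate finite quadratic module of prime power order
which is generated by at most two elements, `Inv(M) ≠ 0` if and only if `|M|` is a
perfect square and `σ(M) = 1`. -/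
theorem invariants_small_rank {M : Type} [AddCommGroup M] [Finite M] (Q : M → QZ)
    (hquad : ∀ (n : ℤ) (x : M), Q (n • x) = (n ^ 2 : ℤ) • Q x)
    (hbil : ∀ x x' y : M, Bf Q (x + x') y = Bf Q x y + Bf Q x' y)
    (hnd : ∀ x : M, (∀ y : M, Bf Q x y = 0) → x = 0)
    (p : ℕ) (hp : p.Prime) (k : ℕ) (hcard : Nat.card M = p ^ k)
    (hgen : ∃ a b : M, AddSubgroup.closure {a, b} = ⊤) :
    (∃ lam : M → ℂ, lam ≠ 0 ∧ Tweil Q lam = lam ∧ Sweil Q lam = lam) ↔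
      ((∃ m : ℕ, Nat.card M = m ^ 2) ∧ gaussSigma Q = 1) := by
  classical
  have := Fintype.ofFinite M
  let B : M →+ M →+ QZ := AddMonoidHom.mk' (fun x => AddMonoidHom.mk' (fun y => Bf Q x y) (by
      intro y y'
      have hs : ∀ a b, Bf Q a b = Bf Q b a := fun a b => by
        simp only [Bf, add_comm b a]; abel
      rw [hs, hbil, hs y, hs y'])) (by
    intro x x'
    ext y
    exact hbil x x' y)
  have hBf : ∀ x y, Bf Q x y = B x y := fun x y => rfl
  have h : QHyp Q B := ⟨fun x y => by rw [← hBf, Bf]; abel, hquad, fun x hx => hnd x hx⟩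
  have hM0 : 0 < Nat.card M := Nat.card_pos
  constructor
  · rintro ⟨lam, h0, hT, hS⟩
    obtain ⟨H, hH, hperp⟩ := h.exists_lagr hp hcard hgen lam h0 (fun x hx => by
      have h1 : ee (Q x) * lam x = lam x := congrFun hT x
      exact ee_eq_one (mul_right_cancel₀ hx (h1.trans (one_mul _).symm)))
      (gaussSigma Q * ((Real.sqrt (Nat.card M) : ℂ))⁻¹) (fun y => by
        have h1 := (congrFun hS y).symm
        rw [Sweil, finsum_eq_sum_of_fintype] at h1
        exact h1)
    obtain ⟨h1, h2⟩ := h.lagr hH hperp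
    refine ⟨⟨_, h1⟩, ?_⟩
    have hc : (Nat.card H : ℂ) ≠ 0 := by exact_mod_cast Nat.card_pos.ne'
    rw [gaussSigma, finsum_eq_sum_of_fintype, h2, h1]
    push_cast
    rw [Real.sqrt_sq (Nat.cast_nonneg _), Complex.ofReal_natCast, inv_mul_cancel₀ hc]
  · rintro ⟨⟨m, hm⟩, hsig⟩
    have hm0 : m ≠ 0 := by rintro rfl; simp at hm
    have hmC : (m : ℂ) ≠ 0 := by exact_mod_cast hm0
    have hsq : ((Real.sqrt (Nat.card M) : ℝ) : ℂ) = m := by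
      rw [hm]; push_cast
      rw [Real.sqrt_sq (Nat.cast_nonneg _), Complex.ofReal_natCast]
    have hG : (∑ x : M, ee (-(Q x))) = m := by
      have h1 := hsig
      rw [gaussSigma, finsum_eq_sum_of_fintype, hsq] at h1
      field_simp at h1
      exact h1
    obtain ⟨H, hH, hperp⟩ := h.back hp hcard hgen hm hG
    obtain ⟨h1, h2⟩ := h.lagr hH hperp
    refine ⟨fun x => if x ∈ H then 1 else 0, ?_, ?_, ?_⟩
    · intro hc
      have := congrFun hc 0
      simp [H.zero_mem] at this
    · funext x
      simp only [Tweil]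
      split_ifs with hx
      · rw [hH x hx, ee_zero, one_mul]
      · rw [mul_zero]
    · funext y
      simp only [Sweil]
      rw [hsig, hsq, finsum_eq_sum_of_fintype]
      have h3 := orth H (B y)
      simp only [hBf, mul_ite, mul_one, mul_zero]
      rw [h3]
      have h4 : (∀ x ∈ H, B y x = 0) ↔ y ∈ H := by
        rw [← mem_perpS, hperp]
      have h5 : (Nat.card H : ℂ) = m := by rw [← h2, hG]
      rw [h5]
      by_cases hy : y ∈ H
      · rw [if_pos (h4.2 hy), if_pos hy]; field_simp
      · rw [if_neg (fun hc => hy (h4.1 hc)), if_neg hy, mul_zero]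
end

section
/- Let p be an odd prime, q = p^α with α ≥ 1, and let a be an integer coprime to p. Then the normalized Gauss sum q^{-1/2} · Σ_{x=0}^{q-1} exp(−2πi·a·x²/q) equals: 1 if α is even; the Legendre symbol (−a|p) if α is odd and p ≡ 1 mod 4; and (−a|p)·i if α is odd and p ≡ 3 mod 4. Equivalently, these are the values of σ(L_q(a)) for the finite quadratic module L_q(a) := (ℤ/q, x ↦ a·x²/q mod ℤ). -/
open Finset in
lemma gA_step (P : ℕ → ℂ) (q : ℂ) (h0 : P 0 = 1) (hs : ∀ k, P (k+1) = P k * (1 - q^(k+1)))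
    (m : ℕ) (hP : ∀ k ≤ m + 2, P k ≠ 0) :
    ∑ j ∈ range (m+3), (-1:ℂ)^j * (P (m+2) / (P j * P (m+2-j))) =
    (1 - q^(m+1)) * ∑ j ∈ range (m+1), (-1:ℂ)^j * (P m / (P j * P (m-j))) := by
  set c : ℕ → ℂ := fun j => (-1:ℂ)^j * (P (m+1) / (P j * P (m+1-j))) with hc
  have hmid : ∀ j ∈ range (m+1), (-1:ℂ)^(j+1) * (P (m+2) / (P (j+1) * P (m+2-(j+1)))) =
      (c (j+1) - c j) + (1 - q^(m+1)) * ((-1:ℂ)^j * (P m / (P j * P (m-j)))) := by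
    intro j hj
    have hj : j ≤ m := by simpa [Nat.lt_succ_iff] using hj
    obtain ⟨d, rfl⟩ := Nat.exists_eq_add_of_le hj
    have e1 : j + d + 2 - (j+1) = d + 1 := by omega
    have e2 : j + d + 1 - (j+1) = d := by omega
    have e3 : j + d + 1 - j = d + 1 := by omega
    have e4 : j + d - j = d := by omega
    simp only [hc, e1, e2, e3, e4]
    have n1 := hP j (by omega)
    have n2 := hP (j+1) (by omega)
    have n3 := hP d (by omega)
    have n4 := hP (d+1) (by omega)
    have s1 := hs (j + d + 1)
    have s2 := hs (j + d)
    rw [hs] at n2 n4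
    rw [s1, s2, hs j, hs d]
    have n2' := right_ne_zero_of_mul n2
    have n4' := right_ne_zero_of_mul n4
    field_simp
    ring
  rw [Finset.sum_range_succ, Finset.sum_range_succ', Finset.sum_congr rfl hmid, sum_add_distrib,
    Finset.sum_range_sub, ← mul_sum]
  have n1 := hP (m+1) (by omega)
  have n2 := hP (m+2) (by omega)
  simp [hc, h0, n1, n2]
  ring

open Finset in
lemma gA_prod (P : ℕ → ℂ) (q : ℂ) (h0 : P 0 = 1) (hs : ∀ k, P (k+1) = P k * (1 - q^(k+1)))
    (h : ℕ) (hP : ∀ k ≤ 2 * h, P k ≠ 0) :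
    ∑ j ∈ range (2*h+1), (-1:ℂ)^j * (P (2*h) / (P j * P (2*h-j))) =
    ∏ i ∈ range h, (1 - q^(2*i+1)) := by
  induction h with
  | zero => simp [h0]
  | succ h ih =>
    have := gA_step P q h0 hs (2*h) (fun k hk => hP k (by omega))
    rw [prod_range_succ, ← ih (fun k hk => hP k (by omega)), mul_comm (∑ j ∈ _, _) _, ← this]
    rfl

open Finset in
lemma gA_main (h : ℕ) (z q : ℂ) (hzq : z^2 * q = 1) (hq : IsPrimitiveRoot q (2*h+1)) :
    ∑ j ∈ range (2*h+1), z^(j*(j+1)) = ∏ i ∈ range h, (1 - q^(2*i+1)) := by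
  set P : ℕ → ℂ := fun k => ∏ i ∈ range k, (1 - q^(i+1)) with hPd
  have h0 : P 0 = 1 := by simp [hPd]
  have hs : ∀ k, P (k+1) = P k * (1 - q^(k+1)) := fun k => by simp [hPd, prod_range_succ]
  have hf : ∀ i < 2*h, 1 - q^(i+1) ≠ 0 := by
    intro i hi e
    exact hq.pow_ne_one_of_pos_of_lt (l := i+1) (by omega) (by omega) (by linear_combination -e)
  have hP : ∀ k ≤ 2*h, P k ≠ 0 := by
    intro k hk
    refine prod_ne_zero_iff.2 fun i hi => hf i ?_
    have := mem_range.1 hi; omega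
  rw [← gA_prod P q h0 hs h hP]
  refine sum_congr rfl fun j hj => ?_
  have hj : j ≤ 2*h := by have := mem_range.1 hj; omega
  induction j with
  | zero => simp [h0, hP (2*h) le_rfl]
  | succ j ih =>
    have ih := ih (by simp; omega) (by omega)
    obtain ⟨d, hd⟩ := Nat.exists_eq_add_of_le hj
    have e1 : 2*h - (j+1) = d := by omega
    have e2 : 2*h - j = d + 1 := by omega
    rw [e2] at ih
    rw [e1]
    have n1 := hP j (by omega)
    have n3 := hP d (by omega)
    have f1 := hf j (by omega)
    have f2 := hf d (by omega)
    have k1 : q^(d+1) * q^(j+1) = 1 := by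
      rw [← pow_add, ← hq.pow_eq_one]; congr 1; omega
    have k2 : (z^2)^(j+1) * q^(j+1) = 1 := by rw [← mul_pow, hzq, one_pow]
    have k3 : q^(d+1) = (z^2)^(j+1) := by
      have : q^(j+1) ≠ 0 := right_ne_zero_of_mul_eq_one k1
      exact mul_right_cancel₀ this (k1.trans k2.symm)
    have : z^((j+1)*(j+1+1)) = z^(j*(j+1)) * (z^2)^(j+1) := by ring
    rw [this, ih, hs d, hs j, k3]
    rw [k3] at f2
    field_simp
    rw [pow_succ (-1:ℂ)]
    linear_combination (-(-1:ℂ)^j * P (2*h)) * k2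

lemma gA_sin (h : ℕ) : ∃ R : ℝ, 0 < R ∧
    ∏ i ∈ Finset.range h, Real.sin (2 * Real.pi * (2*i+1) / (2*h+1)) = (-1)^(h/2) * R := by
  have e : h = (h - h/2) + h/2 := by omega
  have hpi := Real.pi_pos
  have hh : (0:ℝ) < 2*h+1 := by positivity
  refine ⟨(∏ i ∈ Finset.range (h - h/2), Real.sin (2 * Real.pi * (2*i+1) / (2*h+1))) *
    ∏ i ∈ Finset.range (h/2), (-Real.sin (2 * Real.pi * (2*((h - h/2 + i : ℕ):ℝ)+1) / (2*h+1))),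
    mul_pos (Finset.prod_pos ?_) (Finset.prod_pos ?_), ?_⟩
  · intro i hi
    have hi := Finset.mem_range.1 hi
    have : (2*(2*i+1) : ℝ) < 2*h+1 := by
      have : 2*(2*i+1) < 2*h+1 := by omega
      exact_mod_cast this
    apply Real.sin_pos_of_pos_of_lt_pi
    · positivity
    · rw [div_lt_iff₀ hh]; nlinarith
  · intro i hi
    have hi := Finset.mem_range.1 hi
    generalize hk : h - h/2 + i = k
    have h1 : (2*h+1 : ℝ) < 2*(2*k+1) := by
      have : 2*h+1 < 2*(2*k+1) := by omega
      exact_mod_cast this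
    have h2 : (2*k+1 : ℝ) < 2*h+1 := by
      have : 2*k+1 < 2*h+1 := by omega
      exact_mod_cast this
    rw [neg_pos, ← Real.sin_sub_two_pi]
    apply Real.sin_neg_of_neg_of_neg_pi_lt
    · rw [sub_neg, div_lt_iff₀ hh]; nlinarith
    · rw [lt_sub_iff_add_lt, lt_div_iff₀ hh]; nlinarith
  · rw [Finset.prod_neg, Finset.card_range]
    conv_lhs => rw [show Finset.range h = Finset.range ((h - h/2) + h/2) by rw [← e]]
    rw [Finset.prod_range_add]
    have : ((-1:ℝ)^(h/2))*(-1)^(h/2) = 1 := by rw [← mul_pow]; simp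
    linear_combination (-(∏ i ∈ Finset.range (h - h/2), Real.sin (2 * Real.pi * (2*i+1) / (2*h+1))) *
    ∏ i ∈ Finset.range (h/2), (Real.sin (2 * Real.pi * (2*((h - h/2 + i : ℕ):ℝ)+1) / (2*h+1)))) * this

open Finset Complex in
lemma gA_final (h : ℕ) (z : ℂ) (hz : z = exp (2 * Real.pi * I / ((2*h+1 : ℕ) : ℂ))) :
    ∃ R : ℝ, 0 < R ∧ ∑ j ∈ range (2*h+1), z^((j+h+1)^2) = I^(h%2) * R := by
  have hp : IsPrimitiveRoot z (2*h+1) := hz ▸ Complex.isPrimitiveRoot_exp _ (by omega)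
  have hz0 : z ≠ 0 := hp.ne_zero (by omega)
  have hq : IsPrimitiveRoot (z^2)⁻¹ (2*h+1) :=
    (hp.pow_of_coprime 2 (by simp)).inv
  have key := gA_main h z (z^2)⁻¹ (by field_simp) hq
  obtain ⟨R, hR, hsin⟩ := gA_sin h
  refine ⟨2^h * R, by positivity, ?_⟩
  have e1 : ∀ j ∈ range (2*h+1), z^((j+h+1)^2) = z^(h^2) * z^(j*(j+1)) := by
    intro j _
    have : (j+h+1)^2 = h^2 + j*(j+1) + (2*h+1)*(j+1) := by ring
    rw [this, pow_add, pow_mul z (2*h+1), hp.pow_eq_one, one_pow, mul_one, pow_add]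
  rw [sum_congr rfl e1, ← mul_sum, key]
  have e2 : ∀ n : ℕ, z^(n^2) * ∏ i ∈ range n, (1 - (z^2)⁻¹^(2*i+1)) =
      ∏ i ∈ range n, (2 * I * (Real.sin (2 * Real.pi * (2*i+1) / (2*h+1)) : ℝ)) := by
    intro n
    induction n with
    | zero => simp
    | succ n ih =>
      rw [prod_range_succ, prod_range_succ, ← ih]
      have : (2 * I * (Real.sin (2 * Real.pi * (2*n+1) / (2*h+1)) : ℝ) : ℂ) =
          z^(2*n+1) - (z^(2*n+1))⁻¹ := by
        rw [hz, ← Complex.exp_nat_mul, ← Complex.exp_neg]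
        push_cast
        rw [Complex.sin]
        have : (2*n+1 : ℂ) * (2 * Real.pi * I / (2*h+1)) = 2 * Real.pi * (2*n+1) / (2*h+1) * I := by ring
        rw [this, ← neg_mul]
        linear_combination (cexp (-(2 * ↑Real.pi * (2 * ↑n + 1) / (2 * ↑h + 1)) * I) - cexp (2 * ↑Real.pi * (2 * ↑n + 1) / (2 * ↑h + 1) * I)) * I_sq
      rw [this]
      have a1 : z^((n+1)^2) = z^(n^2) * z^(2*n+1) := by ring
      have a2 : ((z^2)⁻¹)^(2*n+1) = (z^(2*n+1))⁻¹ * (z^(2*n+1))⁻¹ := by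
        rw [inv_pow, ← mul_inv]; congr 1; ring
      rw [a1, a2]
      have : z^(2*n+1) ≠ 0 := pow_ne_zero _ hz0
      field_simp
  rw [e2, prod_mul_distrib, prod_const, card_range, ← ofReal_prod, hsin, mul_pow]
  have : I^h = I^(h%2) * (-1)^(h/2) := by
    conv_lhs => rw [← Nat.mod_add_div h 2]
    rw [pow_add, pow_mul, I_sq]
  have t : ((-1:ℂ)^(h/2))*(-1)^(h/2) = 1 := by rw [← mul_pow]; simp
  rw [this]; push_cast
  linear_combination (2^h * I^(h%2) * (R:ℂ)) * t

open Finset in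
lemma gB_zmod (N : ℕ) [NeZero N] (f : ZMod N → ℂ) :
    ∑ x ∈ range N, f (x : ZMod N) = ∑ x : ZMod N, f x := by
  refine sum_nbij' (fun x => (x : ZMod N)) (fun x => x.val) ?_ ?_ ?_ ?_ ?_
  · simp
  · intro x _; simpa using ZMod.val_lt x
  · intro x hx; exact ZMod.val_cast_of_lt (mem_range.1 hx)
  · intro x _; simp
  · intro x _; rfl

open Finset in
lemma gB_split (A B : ℕ) (f : ℕ → ℂ) :
    ∑ x ∈ range (A * B), f x = ∑ z ∈ range B, ∑ y ∈ range A, f (A * z + y) := by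
  induction B with
  | zero => simp
  | succ B ih => rw [sum_range_succ, ← ih, Nat.mul_succ, sum_range_add]

open Finset in
lemma gB_sq (p : ℕ) [Fact p.Prime] (hodd : p ≠ 2) (ψ : AddChar (ZMod p) ℂ) (hψ : ψ ≠ 1) :
    ∑ x : ZMod p, ψ (x^2) =
      gaussSum ((quadraticChar (ZMod p)).ringHomComp (Int.castRingHom ℂ)) ψ := by
  have hF : ringChar (ZMod p) ≠ 2 := by rwa [ZMod.ringChar_zmod_n]
  have h1 : ∑ x : ZMod p, ψ (x^2) = ∑ y : ZMod p, ∑ x ∈ univ with x^2 = y, ψ (x^2) :=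
    (sum_fiberwise _ _ _).symm
  have h2 : ∀ y : ZMod p, ∑ x ∈ univ with x^2 = y, ψ (x^2) =
      ((quadraticChar (ZMod p) y : ℤ) : ℂ) * ψ y + ψ y := by
    intro y
    have h3 : ∑ x ∈ univ with x^2 = y, ψ (x^2) = ∑ x ∈ univ with x^2 = y, ψ y :=
      sum_congr rfl fun x hx => by rw [(mem_filter.1 hx).2]
    have h4 := quadraticChar_card_sqrts hF y
    have h5 : ({x : ZMod p | x ^ 2 = y}.toFinset) = univ.filter (fun x => x^2 = y) := by
      ext; simp
    rw [h5] at h4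
    have h6 : ((#(univ.filter (fun x : ZMod p => x^2 = y)) : ℕ) : ℂ) =
      ((quadraticChar (ZMod p) y : ℤ) : ℂ) + 1 := by exact_mod_cast congrArg (Int.cast : ℤ → ℂ) h4
    rw [h3, sum_const, nsmul_eq_mul, h6]; ring
  rw [h1, sum_congr rfl (fun y _ => h2 y), sum_add_distrib, AddChar.sum_eq_zero_of_ne_one hψ,
    add_zero]
  rfl

open Finset Complex in
lemma gB_one (p : ℕ) [Fact p.Prime] (hodd : p ≠ 2) :
    ∑ x : ZMod p, (ZMod.stdAddChar (x^2) : ℂ) = I^((p/2)%2) * (Real.sqrt p : ℝ) := by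
  have hpo : p % 2 = 1 := (Nat.Prime.eq_two_or_odd (Fact.out : p.Prime)).resolve_left hodd
  obtain ⟨R, hR, hG⟩ := gA_final (p/2) _ rfl
  have e : 2 * (p/2) + 1 = p := by omega
  rw [e] at hG
  have hψ := ZMod.isPrimitive_stdAddChar p
  have hψ1 : (ZMod.stdAddChar : AddChar (ZMod p) ℂ) ≠ 1 := by
    have := hψ (a := 1) one_ne_zero
    simpa using this
  have h1 : ∑ x : ZMod p, (ZMod.stdAddChar (x^2) : ℂ) = I^((p/2)%2) * R := by
    clear e hpo
    generalize p/2 = h at hG ⊢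
    rw [← hG, ← Equiv.sum_comp (Equiv.addRight ((h + 1 : ℕ) : ZMod p)), ← gB_zmod]
    refine sum_congr rfl fun j _ => ?_
    have : ((Equiv.addRight ((h + 1 : ℕ) : ZMod p)) (j : ZMod p))^2
       = (((j + h+1)^2 : ℕ) : ℤ) := by
      simp [add_assoc]
    rw [this, ZMod.stdAddChar_coe, ← Complex.exp_nat_mul]
    congr 1
    push_cast
    ring
  have h2 := gB_sq p hodd _ hψ1
  have hF : ringChar (ZMod p) ≠ 2 := by rwa [ZMod.ringChar_zmod_n]
  have h3 := gaussSum_sq (R := ZMod p) (R' := ℂ)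
    (χ := (quadraticChar (ZMod p)).ringHomComp (Int.castRingHom ℂ))
    ((MulChar.ringHomComp_ne_one_iff (RingHom.injective_int _)).2 (quadraticChar_ne_one hF))
    ((quadraticChar_isQuadratic _).comp _) hψ
  rw [← h2, h1, MulChar.ringHomComp_apply, quadraticChar_neg_one hF, ZMod.card,
    ZMod.χ₄_eq_neg_one_pow hpo, mul_pow, ← pow_mul, mul_comm _ 2, pow_mul, I_sq,
    ← neg_one_pow_eq_pow_mod_two] at h3
  have h4 : ((R:ℂ))^2 = p := by
    have : ((-1:ℂ)^(p/2)) ≠ 0 := pow_ne_zero _ (by norm_num)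
    apply mul_left_cancel₀ this
    simpa using h3
  have h5 : R^2 = p := by exact_mod_cast h4
  rw [h1, ← h5, Real.sqrt_sq hR.le]

open Finset Complex in
lemma gB_b (p : ℕ) [Fact p.Prime] (hodd : p ≠ 2) (b : ℤ) (hb : (b : ZMod p) ≠ 0) :
    ∑ x ∈ range p, exp (2 * Real.pi * I * b * (x:ℂ)^2 / p) =
      legendreSym p b * (I^((p/2)%2) * (Real.sqrt p : ℝ)) := by
  have hψ := ZMod.isPrimitive_stdAddChar p
  have hψ1 : (ZMod.stdAddChar : AddChar (ZMod p) ℂ) ≠ 1 := by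
    have := hψ (a := 1) one_ne_zero
    simpa using this
  have hF : ringChar (ZMod p) ≠ 2 := by rwa [ZMod.ringChar_zmod_n]
  have h1 : ∑ x ∈ range p, exp (2 * Real.pi * I * b * (x:ℂ)^2 / p) =
      ∑ x : ZMod p, (ZMod.stdAddChar.mulShift (b : ZMod p) (x^2) : ℂ) := by
    rw [← gB_zmod]
    refine sum_congr rfl fun x _ => ?_
    have : (b : ZMod p) * (x : ZMod p)^2 = ((b * x^2 : ℤ) : ZMod p) := by push_cast; ring
    rw [AddChar.mulShift_apply, this, ZMod.stdAddChar_coe]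
    push_cast
    congr 1
    ring
  rw [h1, ← gB_one p hodd, gB_sq p hodd _ hψ1, gB_sq p hodd _ (hψ hb)]
  have := gaussSum_mulShift ((quadraticChar (ZMod p)).ringHomComp (Int.castRingHom ℂ))
    (ZMod.stdAddChar : AddChar (ZMod p) ℂ) (Units.mk0 _ hb)
  rw [← this]
  have hsq : ((legendreSym p b : ℤ) : ℂ) * (legendreSym p b : ℤ) = 1 := by
    have := legendreSym.sq_one p hb
    rw [sq] at this
    exact_mod_cast this
  rw [MulChar.ringHomComp_apply]
  change _ = _ * (((legendreSym p b : ℤ) : ℂ) * _)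
  rw [← mul_assoc, hsq, one_mul]
  rfl

open Finset Complex in
lemma gB_step (p : ℕ) [Fact p.Prime] (hodd : p ≠ 2) (b : ℤ) (hb : (b : ZMod p) ≠ 0) (n : ℕ) :
    ∑ x ∈ range (p^(n+2)), exp (2 * Real.pi * I * b * (x:ℂ)^2 / (p:ℂ)^(n+2)) =
      p * ∑ x ∈ range (p^n), exp (2 * Real.pi * I * b * (x:ℂ)^2 / (p:ℂ)^n) := by
  have hp0 : (p:ℂ) ≠ 0 := by exact_mod_cast (Fact.out : p.Prime).ne_zero
  have h2 : (2 : ZMod p) ≠ 0 := by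
    have : ((2:ℕ) : ZMod p) ≠ 0 := by
      rw [Ne, ZMod.natCast_eq_zero_iff]
      intro h
      exact hodd ((Nat.prime_dvd_prime_iff_eq Fact.out Nat.prime_two).1 h)
    exact_mod_cast this
  have inner : ∀ y : ℕ, ∑ z ∈ range p, exp (2 * Real.pi * I * (2 * b * y * z) / p) =
      if p ∣ y then (p : ℂ) else 0 := by
    intro y
    have h1 : ∑ z ∈ range p, exp (2 * Real.pi * I * (2 * b * y * z) / p) =
       ∑ z : ZMod p, (ZMod.stdAddChar (z * (2 * (b : ZMod p) * (y : ZMod p) - 0)) : ℂ) := by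
      rw [← gB_zmod]
      refine sum_congr rfl fun x _ => ?_
      have : (x : ZMod p) * (2 * (b : ZMod p) * (y : ZMod p) - 0) = ((2 * b * y * x : ℤ) : ZMod p) := by push_cast; ring
      rw [this, ZMod.stdAddChar_coe]
      push_cast
      rfl
    rw [h1]
    simp only [sub_zero]
    rw [AddChar.sum_mulShift _ (ZMod.isPrimitive_stdAddChar p), ZMod.card]
    simp [h2, hb, ZMod.natCast_eq_zero_iff]
  have hterm : ∀ y z : ℕ, exp (2 * Real.pi * I * b * ((p^(n+1) * z + y : ℕ):ℂ)^2 / (p:ℂ)^(n+2)) =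
      exp (2 * Real.pi * I * b * (y:ℂ)^2 / (p:ℂ)^(n+2)) *
        exp (2 * Real.pi * I * (2 * b * y * z) / p) := by
    intro y z
    rw [← Complex.exp_add]
    have : 2 * Real.pi * I * b * ((p^(n+1) * z + y : ℕ):ℂ)^2 / (p:ℂ)^(n+2) =
       2 * Real.pi * I * b * (y:ℂ)^2 / (p:ℂ)^(n+2) + 2 * Real.pi * I * (2 * b * y * z) / p +
       ((b * p^n * z^2 : ℤ) : ℂ) * (2 * Real.pi * I) := by
      push_cast
      field_simp
      ring
    rw [this, Complex.exp_add _ (((b * p^n * z^2 : ℤ) : ℂ) * (2 * Real.pi * I)),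
      Complex.exp_int_mul_two_pi_mul_I, mul_one]
  have e1 : p^(n+2) = p^(n+1) * p := by ring
  rw [e1, gB_split, sum_comm]
  simp_rw [hterm, ← mul_sum, inner]
  have e2 : p^(n+1) = p * p^n := by ring
  rw [e2, gB_split, mul_sum]
  refine sum_congr rfl fun u _ => ?_
  have hpp := (Fact.out : p.Prime).pos
  rw [sum_eq_single 0]
  · simp only [add_zero, dvd_mul_right, if_true]
    rw [mul_comm]
    congr 2
    push_cast
    field_simp
    ring
  · intro v hv hv0
    rw [if_neg, mul_zero]
    rw [Nat.dvd_add_right (dvd_mul_right _ _)]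
    intro h
    exact absurd (Nat.le_of_dvd (Nat.pos_of_ne_zero hv0) h) (by have := mem_range.1 hv; omega)
  · simp [hpp.ne']

open Finset Complex in
lemma gB_norm (p : ℕ) [Fact p.Prime] (hodd : p ≠ 2) (b : ℤ) (hb : (b : ZMod p) ≠ 0) (n : ℕ) :
    ((Real.sqrt (p ^ n) : ℝ) : ℂ)⁻¹ *
      ∑ x ∈ range (p^n), exp (2 * Real.pi * I * b * (x:ℂ)^2 / (p:ℂ)^n) =
      if Even n then 1 else legendreSym p b * I^((p/2)%2) := by
  have hp : (0:ℝ) < p := by exact_mod_cast (Fact.out : p.Prime).pos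
  induction n using Nat.strong_induction_on with
  | _ n ih =>
    match n with
    | 0 => simp
    | 1 =>
      have : ((Real.sqrt p : ℝ) : ℂ) ≠ 0 := by
        exact_mod_cast (Real.sqrt_pos.2 hp).ne'
      simp only [pow_one]
      rw [gB_b p hodd b hb]
      simp
      field_simp
    | n+2 =>
      have e : Real.sqrt ((p:ℝ)^(n+2)) = p * Real.sqrt ((p:ℝ)^n) := by
        rw [pow_add, mul_comm, Real.sqrt_mul (by positivity), Real.sqrt_sq hp.le]
      rw [gB_step p hodd b hb, e]
      have := ih n (by omega)
      have e2 : Even (n+2) ↔ Even n := by simp [Nat.even_add]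
      simp only [e2]
      rw [← this]
      have hp0 : (p:ℂ) ≠ 0 := by exact_mod_cast hp.ne'
      push_cast
      field_simp

/-- evaluation of the normalized quadratic Gauss sum
`q^{-1/2} ∑_{x mod q} exp(-2πi a x²/q)` for `q = p^α` an odd prime power and
`gcd(a,p) = 1`; equivalently the values of `σ(L_q(a))` for
`L_q(a) = (ℤ/q, a x²/q)`. -/
theorem odd_gauss_sum_values (p : ℕ) [Fact p.Prime] (hodd : p ≠ 2)
    (α : ℕ) (hα : 1 ≤ α) (a : ℤ) (ha : Int.gcd a p = 1) :
    (Even α →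
      ((Real.sqrt (p ^ α) : ℂ))⁻¹ * ∑ x ∈ Finset.range (p ^ α),
        Complex.exp (-(2 * Real.pi * Complex.I) * a * (x : ℂ) ^ 2 / (p ^ α : ℂ)) = 1) ∧
    (Odd α → p % 4 = 1 →
      ((Real.sqrt (p ^ α) : ℂ))⁻¹ * ∑ x ∈ Finset.range (p ^ α),
        Complex.exp (-(2 * Real.pi * Complex.I) * a * (x : ℂ) ^ 2 / (p ^ α : ℂ)) =
        (legendreSym p (-a) : ℂ)) ∧
    (Odd α → p % 4 = 3 →
      ((Real.sqrt (p ^ α) : ℂ))⁻¹ * ∑ x ∈ Finset.range (p ^ α),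
        Complex.exp (-(2 * Real.pi * Complex.I) * a * (x : ℂ) ^ 2 / (p ^ α : ℂ)) =
        (legendreSym p (-a) : ℂ) * Complex.I) ∧
    gaussSigma (fun x : ZMod (p ^ α) => (((a * (x.val : ℚ) ^ 2 / (p ^ α : ℚ)) : ℚ) : QZ)) =
      ((Real.sqrt (p ^ α) : ℂ))⁻¹ * ∑ x ∈ Finset.range (p ^ α),
        Complex.exp (-(2 * Real.pi * Complex.I) * a * (x : ℂ) ^ 2 / (p ^ α : ℂ)) := by
  have hb : ((-a : ℤ) : ZMod p) ≠ 0 := by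
    rw [Int.cast_neg, neg_ne_zero, Ne, ZMod.intCast_zmod_eq_zero_iff_dvd]
    intro h
    have h1 : (p : ℤ) ∣ (Int.gcd a p : ℤ) := Int.dvd_coe_gcd h dvd_rfl
    rw [ha] at h1
    exact (Fact.out : p.Prime).one_lt.ne' (by exact_mod_cast Int.eq_one_of_dvd_one (by positivity) h1)
  have key := gB_norm p hodd (-a) hb α
  have hs : ∀ x : ℕ, Complex.exp (-(2 * Real.pi * Complex.I) * a * (x : ℂ) ^ 2 / (p ^ α : ℂ)) =
      Complex.exp (2 * Real.pi * Complex.I * ((-a : ℤ) : ℂ) * (x : ℂ) ^ 2 / (p ^ α : ℂ)) := by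
    intro x
    congr 1
    push_cast
    ring
  have : NeZero (p ^ α) := ⟨pow_ne_zero _ (Fact.out : p.Prime).ne_zero⟩
  refine ⟨fun h => ?_, fun h h4 => ?_, fun h h4 => ?_, ?_⟩
  · simp_rw [hs]
    rw [key, if_pos h]
  · simp_rw [hs]
    rw [key, if_neg (Nat.not_even_iff_odd.2 h), show (p/2)%2 = 0 by omega]
    simp
  · simp_rw [hs]
    rw [key, if_neg (Nat.not_even_iff_odd.2 h), show (p/2)%2 = 1 by omega]
    simp
  · unfold gaussSigma
    rw [finsum_eq_sum_of_fintype, ← gB_zmod, Nat.card_zmod]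
    push_cast
    congr 1
    refine Finset.sum_congr rfl fun x hx => ?_
    rw [ZMod.val_cast_of_lt (Finset.mem_range.1 hx), ← AddCircle.coe_neg]
    change Complex.exp _ = _
    congr 1
    push_cast
    ring
end

section
/- Call two nondegenerate finite quadratic modules (M,Q_M) and (N,Q_N) Witt equivalent if there exist isotropic subgroups U ≤ M and V ≤ N and a group isomorphism φ : U^⊥/U → V^⊥/V with Q̄_N ∘ φ = Q̄_M. Then M and N are Witt equivalent if and only if |M|·|N| is a perfect square (i.e. their orders agree up to a rational square) and σ_p(M) = σ_p(N) for all primes p. -/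
namespace WittAux

open Classical in
lemma ee_coe (q : ℚ) : ee (q : QZ) = Complex.exp (2 * Real.pi * Complex.I * (q : ℂ)) :=
  expPeriodic.lift_coe q

lemma ee_add (x y : QZ) : ee (x + y) = ee x * ee y := by
  induction x using QuotientAddGroup.induction_on with | _ x => ?_
  induction y using QuotientAddGroup.induction_on with | _ y => ?_
  rw [← QuotientAddGroup.mk_add]
  change ee ((x + y : ℚ) : QZ) = ee (x : QZ) * ee (y : QZ)
  rw [ee_coe, ee_coe, ee_coe, ← Complex.exp_add]
  push_cast
  ring_nf

lemma ee_zero : ee 0 = 1 := by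
  have := ee_coe 0
  simpa using this

lemma ee_eq_one {y : QZ} : ee y = 1 ↔ y = 0 := by
  constructor
  · induction y using QuotientAddGroup.induction_on with | _ y => ?_
    change ee (y : QZ) = 1 → (y : QZ) = 0
    rw [ee_coe, Complex.exp_eq_one_iff]
    rintro ⟨n, hn⟩
    rw [AddCircle.coe_eq_zero_iff]
    refine ⟨n, ?_⟩
    have h : (2 * Real.pi * Complex.I : ℂ) ≠ 0 := Complex.two_pi_I_ne_zero
    have h2 : (y : ℂ) = n := by
      apply mul_left_cancel₀ h
      rw [hn, mul_comm]
    have h3 : y = n := by exact_mod_cast h2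
    simp [h3]
  · rintro rfl
    exact ee_zero

lemma ee_nsmul (n : ℕ) (y : QZ) : ee (n • y) = ee y ^ n := by
  induction n with
  | zero => simp [ee_zero]
  | succ n ih => rw [succ_nsmul, ee_add, ih, pow_succ]

lemma ee_neg (y : QZ) : ee (-y) = (starRingEnd ℂ) (ee y) := by
  induction y using QuotientAddGroup.induction_on with | _ y => ?_
  change ee ((-y : ℚ) : QZ) = (starRingEnd ℂ) (ee (y : QZ))
  rw [ee_coe, ee_coe, ← Complex.exp_conj]
  have : (starRingEnd ℂ) 2 = 2 := Complex.conj_ofNat 2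
  simp [this]

/-- The character attached to a homomorphism to `ℚ/ℤ`. -/
noncomputable def chr {A : Type} [AddCommGroup A] (f : A →+ QZ) : AddChar A ℂ where
  toFun a := ee (f a)
  map_zero_eq_one' := by simp [ee_zero]
  map_add_eq_mul' a b := by simp [ee_add]

open Classical in
lemma sum_chr {A : Type} [AddCommGroup A] [Fintype A] (f : A →+ QZ) :
    ∑ a, ee (f a) = if (∀ a, f a = 0) then (Fintype.card A : ℂ) else 0 := by
  have h := AddChar.sum_eq_ite (chr f)
  have h2 : chr f = 0 ↔ ∀ a, f a = 0 := by
    constructor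
    · intro h a
      have := DFunLike.congr_fun h a
      exact ee_eq_one.1 this
    · intro h
      ext a
      change ee (f a) = 1
      rw [h a, ee_zero]
  simp only [h2] at h
  exact h

/-- quadratic forms -/
structure IsFQ {A : Type} [AddCommGroup A] (Q : A → QZ) : Prop where
  quad : ∀ (n : ℤ) (x : A), Q (n • x) = (n ^ 2 : ℤ) • Q x
  bil : ∀ x x' y : A, Bf Q (x + x') y = Bf Q x y + Bf Q x' y

section
variable {A : Type} [AddCommGroup A] {Q : A → QZ}

lemma Bf_comm (x y : A) : Bf Q x y = Bf Q y x := by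
  unfold Bf
  rw [add_comm x y]; abel

lemma Q_add (x y : A) : Q (x + y) = Q x + Q y + Bf Q x y := by
  unfold Bf; abel

/-- `B(·, y)` -/
def Bh (h : IsFQ Q) (y : A) : A →+ QZ := AddMonoidHom.mk' (fun x => Bf Q x y) (fun a b => h.bil a b y)

/-- orthogonal complement -/
def perp (h : IsFQ Q) (L : AddSubgroup A) : AddSubgroup A where
  carrier := {y | ∀ x ∈ L, Bf Q x y = 0}
  zero_mem' := by
    intro x _
    rw [Bf_comm]
    exact (Bh h x).map_zero
  add_mem' := by
    intro a b ha hb x hx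
    rw [Bf_comm, h.bil, Bf_comm, ha x hx, Bf_comm, hb x hx, add_zero]
  neg_mem' := by
    intro a ha x hx
    rw [Bf_comm]
    have := (Bh h x).map_neg a
    change Bf Q (-a) x = - Bf Q a x at this
    rw [this, Bf_comm, ha x hx, neg_zero]

lemma mem_perp (h : IsFQ Q) (L : AddSubgroup A) (y : A) :
    y ∈ perp h L ↔ ∀ x ∈ L, Bf Q x y = 0 := Iff.rfl

lemma le_perp (h : IsFQ Q) {L : AddSubgroup A} (hL : ∀ x ∈ L, Q x = 0) : L ≤ perp h L := by
  intro y hy x hx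
  unfold Bf
  rw [hL _ (L.add_mem hx hy), hL _ hx, hL _ hy]; simp

open Classical in
lemma card_perp [Finite A] (h : IsFQ Q) (hnd : ∀ x : A, (∀ y : A, Bf Q x y = 0) → x = 0)
    (L : AddSubgroup A) : Nat.card L * Nat.card (perp h L) = Nat.card A := by
  have := Fintype.ofFinite A
  have h1 : ∑ x : A, ∑ l : L, ee (Bf Q (l : A) x) = Nat.card L * Nat.card (perp h L) := by
    have : ∀ x : A, ∑ l : L, ee (Bf Q (l : A) x) = if x ∈ perp h L then (Nat.card L : ℂ) else 0 := by
      intro x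
      have := sum_chr ((Bh h x).comp L.subtype)
      rw [Nat.card_eq_fintype_card]
      refine this.trans ?_
      refine if_congr ?_ rfl rfl
      rw [mem_perp]
      exact ⟨fun H y hy => H ⟨y, hy⟩, fun H y => H y y.2⟩
    rw [Finset.sum_congr rfl (fun x _ => this x), ← Finset.sum_filter, Finset.sum_const, nsmul_eq_mul,
      mul_comm]
    congr 2
    rw [Nat.card_eq_fintype_card, Fintype.card_subtype]
  have h2 : ∑ x : A, ∑ l : L, ee (Bf Q (l : A) x) = Nat.card A := by
    rw [Finset.sum_comm]
    have : ∀ l : L, ∑ x : A, ee (Bf Q (l : A) x) = if l = 0 then (Nat.card A : ℂ) else 0 := by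
      intro x
      have := sum_chr (Bh h (x : A))
      rw [Nat.card_eq_fintype_card]
      simp_rw [Bf_comm (x : A)]
      refine this.trans ?_
      refine if_congr ?_ rfl rfl
      constructor
      · intro H
        apply Subtype.ext
        apply hnd
        intro y
        rw [Bf_comm]
        exact H y
      · rintro rfl a
        change Bf Q a 0 = 0
        rw [Bf_comm]
        exact (Bh h a).map_zero
    rw [Finset.sum_congr rfl (fun x _ => this x)]
    simp
  have := h1.symm.trans h2
  exact_mod_cast this

lemma perp_perp [Finite A] (h : IsFQ Q) (hnd : ∀ x : A, (∀ y : A, Bf Q x y = 0) → x = 0)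
    (L : AddSubgroup A) : perp h (perp h L) = L := by
  symm
  apply AddSubgroup.eq_of_le_of_card_ge
  · intro x hx y hy
    rw [Bf_comm]
    exact hy x hx
  · have h1 := card_perp h hnd L
    have h2 := card_perp h hnd (perp h L)
    rw [← h1, mul_comm] at h2
    have : 0 < Nat.card (perp h L) := Nat.card_pos
    have := Nat.eq_of_mul_eq_mul_right this h2
    exact this.le

open Classical in
lemma gauss_perp [Fintype A] (h : IsFQ Q) (L : AddSubgroup A) (hL : ∀ x ∈ L, Q x = 0) :
    ∑ x : A, ee (-(Q x)) = ∑ x : perp h L, ee (-(Q (x : A))) := by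
  have h1 : ∑ x : A, ∑ l : L, ee (-(Q (x + l))) = (Nat.card L : ℂ) * ∑ x : A, ee (-(Q x)) := by
    rw [Finset.sum_comm]
    have : ∀ l : L, ∑ x : A, ee (-(Q (x + l))) = ∑ x : A, ee (-(Q x)) := fun l =>
      Fintype.sum_equiv (Equiv.addRight (l : A)) _ _ (fun x => rfl)
    rw [Finset.sum_congr rfl (fun x _ => this x), Finset.sum_const, nsmul_eq_mul]
    simp
  have h2 : ∑ x : A, ∑ l : L, ee (-(Q (x + l))) =
      (Nat.card L : ℂ) * ∑ x : perp h L, ee (-(Q (x : A))) := by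
    have : ∀ x : A, ∑ l : L, ee (-(Q (x + l))) =
        if x ∈ perp h L then (Nat.card L : ℂ) * ee (-(Q x)) else 0 := by
      intro x
      have h3 := sum_chr (-((Bh h x).comp L.subtype))
      have h4 : ∀ l : L, ee (-(Q (x + l))) = ee (-(Q x)) * ee ((-((Bh h x).comp L.subtype)) l) := by
        intro l
        rw [← ee_add]
        congr 1
        rw [Q_add (Q := Q), hL _ l.2, Bf_comm]
        change _ = - Q x + - Bf Q (l : A) x
        abel
      rw [Finset.sum_congr rfl (fun l _ => h4 l), ← Finset.mul_sum, h3, mul_ite, mul_zero]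
      refine if_congr ?_ (by rw [mul_comm]; simp) rfl
      rw [mem_perp]
      constructor
      · intro H y hy
        have := H ⟨y, hy⟩
        exact neg_eq_zero.1 this
      · intro H y
        exact neg_eq_zero.2 (H y y.2)
    rw [Finset.sum_congr rfl (fun x _ => this x), ← Finset.sum_filter, Finset.mul_sum]
    exact Finset.sum_subtype _ (by simp) _
  have h5 : (Nat.card L : ℂ) ≠ 0 := by
    have : Nat.card L ≠ 0 := Nat.card_pos.ne'
    exact_mod_cast this
  exact mul_left_cancel₀ h5 (h1.symm.trans h2)

end

lemma galois {ι : Type} [Fintype ι] (g : ι → QZ) (q : ℕ) (hq : 0 < q) (hg : ∀ i, q • g i = 0)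
    (s : ℤ) (hs : ∑ i, ee (g i) = s) (a : ℕ) (ha : a.Coprime q) :
    ∑ i, ee (a • g i) = s := by
  have hζ := Complex.isPrimitiveRoot_exp q hq.ne'
  set ζ := Complex.exp (2 * Real.pi * Complex.I / q) with hζd
  have hex : ∀ i, ∃ j : ℕ, ζ ^ j = ee (g i) := by
    intro i
    have : NeZero q := ⟨hq.ne'⟩
    obtain ⟨j, _, hj⟩ := hζ.eq_pow_of_pow_eq_one
      (show ee (g i) ^ q = 1 by rw [← ee_nsmul, hg, ee_zero])
    exact ⟨j, hj⟩
  choose j hj using hex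
  let f : Polynomial ℤ := ∑ i, Polynomial.X ^ j i - Polynomial.C s
  have h1 : Polynomial.aeval ζ f = 0 := by
    simp [f, hj, hs]
  have h2 : minpoly ℤ ζ ∣ f := minpoly.isIntegrallyClosed_dvd (hζ.isIntegral hq) h1
  rw [hζ.minpoly_eq_pow_coprime ha] at h2
  have h3 : Polynomial.aeval (ζ ^ a) f = 0 := by
    obtain ⟨c, hc⟩ := h2
    rw [hc, map_mul, minpoly.aeval, zero_mul]
  have h4 : ∀ i, (ζ ^ a) ^ j i = ee (a • g i) := by
    intro i
    rw [ee_nsmul, ← hj, ← pow_mul, ← pow_mul, mul_comm]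
  simpa [f, h4, sub_eq_zero] using h3

lemma geom (y : QZ) (n : ℕ) (hy : n • y = 0) :
    ∑ a ∈ Finset.range n, ee (a • y) = if y = 0 then (n : ℂ) else 0 := by
  split_ifs with h
  · subst h
    simp [ee_zero]
  · simp_rw [ee_nsmul]
    rw [geom_sum_eq (fun H => h (ee_eq_one.1 H)), ← ee_nsmul, hy, ee_zero]
    simp

lemma ram (p k : ℕ) (hp : p.Prime) (y : QZ) (hy : p ^ (k + 1) • y = 0) (hy0 : y ≠ 0) :
    (∑ a ∈ (Finset.range (p ^ (k + 1))).filter (fun a => a.Coprime (p ^ (k + 1))),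
      ee (a • y)).re ≤ 0 := by
  have h1 := geom y _ hy
  rw [if_neg hy0, ← Finset.sum_filter_add_sum_filter_not _ (fun a => a.Coprime (p ^ (k + 1)))] at h1
  have h2 : ∑ a ∈ (Finset.range (p ^ (k + 1))).filter (fun a => ¬ a.Coprime (p ^ (k + 1))),
      ee (a • y) = ∑ b ∈ Finset.range (p ^ k), ee (b • (p • y)) := by
    symm
    apply Finset.sum_bij (fun b _ => b * p)
    · intro b hb
      simp only [Finset.mem_filter, Finset.mem_range] at hb ⊢
      refine ⟨?_, ?_⟩
      · rw [pow_succ]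
        exact Nat.mul_lt_mul_of_pos_right hb hp.pos
      · intro H
        have := Nat.Coprime.coprime_dvd_left (Dvd.intro_left b rfl) H
        have := Nat.Coprime.coprime_dvd_right (dvd_pow_self p (Nat.succ_ne_zero k)) this
        rw [Nat.coprime_self] at this
        exact hp.one_lt.ne' this
    · intro a _ b _ hab
      exact Nat.eq_of_mul_eq_mul_right hp.pos hab
    · intro a ha
      simp only [Finset.mem_filter, Finset.mem_range] at ha
      have : p ∣ a := by
        by_contra H
        exact ha.2 (Nat.Coprime.pow_right _ ((Nat.Prime.coprime_iff_not_dvd hp).2 H).symm)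
      obtain ⟨b, rfl⟩ := this
      refine ⟨b, ?_, mul_comm _ _⟩
      rw [Finset.mem_range]
      have := ha.1
      rw [pow_succ, mul_comm] at this
      exact Nat.lt_of_mul_lt_mul_right this
    · intro b _
      rw [mul_smul]
  rw [h2, geom (p • y) (p ^ k) (by rw [← mul_smul, ← pow_succ, hy])] at h1
  rw [eq_neg_of_add_eq_zero_left h1]
  split_ifs
  · rw [Complex.neg_re, Complex.natCast_re]
    exact neg_nonpos.2 (Nat.cast_nonneg _)
  · simp

open Classical in
lemma trace_bound {ι : Type} [Fintype ι] (g : ι → QZ) (p k : ℕ) (hp : p.Prime)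
    (hg : ∀ i, p ^ (k + 1) • g i = 0) (s : ℕ) (hs : ∑ i, ee (g i) = s) :
    s ≤ (Finset.univ.filter (fun i => g i = 0)).card := by
  have hq : 0 < p ^ (k + 1) := pow_pos hp.pos _
  set T := (Finset.range (p ^ (k + 1))).filter (fun a => a.Coprime (p ^ (k + 1))) with hT
  have h1 : ∀ a ∈ T, ∑ i, ee (a • g i) = (s : ℂ) := by
    intro a ha
    have := galois g _ hq hg s (by simpa using hs) a (Finset.mem_filter.1 ha).2
    simpa using this
  have h2 : ∑ i, ∑ a ∈ T, ee (a • g i) = T.card * (s : ℂ) := by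
    rw [Finset.sum_comm, Finset.sum_congr rfl h1]
    simp
  have h3 : ∀ i, (∑ a ∈ T, ee (a • g i)).re ≤ if g i = 0 then (T.card : ℝ) else 0 := by
    intro i
    split_ifs with h
    · simp [h, ee_zero]
    · exact ram p k hp _ (hg i) h
  have h4 : (T.card : ℝ) * s ≤ T.card * (Finset.univ.filter (fun i => g i = 0)).card := by
    have h5 := congrArg Complex.re h2
    rw [Complex.re_sum] at h5
    have h6 := Finset.sum_le_sum (fun i (_ : i ∈ Finset.univ) => h3 i)
    rw [h5, ← Finset.sum_filter, Finset.sum_const, nsmul_eq_mul] at h6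
    have : ((T.card : ℂ) * (s : ℂ)).re = (T.card : ℝ) * s := by
      norm_cast
    rw [this] at h6
    linarith
  have h7 : 0 < T.card := by
    apply Finset.card_pos.2
    refine ⟨1, Finset.mem_filter.2 ⟨Finset.mem_range.2 ?_, Nat.coprime_one_left _⟩⟩
    exact Nat.one_lt_pow (Nat.succ_ne_zero k) hp.one_lt
  have h8 : T.card * s ≤ T.card * (Finset.univ.filter (fun i => g i = 0)).card := by exact_mod_cast h4
  exact Nat.le_of_mul_le_mul_left h8 h7

lemma card_primary (A : Type) [AddCommGroup A] [Finite A] (p : ℕ) (hp : p.Prime) :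
    Nat.card (primaryComp A p) = p ^ (Nat.card A).factorization p := by
  have : Fact p.Prime := ⟨hp⟩
  let P : Subgroup (Multiplicative A) := AddSubgroup.toSubgroup (primaryComp A p)
  have hP : IsPGroup p P := by
    rintro ⟨g, k, hk⟩
    exact ⟨k, Subtype.ext hk⟩
  obtain ⟨S, hS⟩ := hP.exists_le_sylow
  have hSP : (S : Subgroup (Multiplicative A)) ≤ P := by
    intro x hx
    obtain ⟨k, hk⟩ := S.isPGroup' ⟨x, hx⟩
    exact ⟨k, congrArg Subtype.val hk⟩
  have h := S.card_eq_multiplicity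
  have h2 : P = S := le_antisymm hS hSP
  have h3 : Nat.card P = p ^ (Nat.card A).factorization p := by
    rw [h2]; exact h
  exact h3

section
variable {A : Type} [AddCommGroup A] {Q : A → QZ}

/-- restriction to primary component -/
abbrev QP (Q : A → QZ) (p : ℕ) : primaryComp A p → QZ := fun x => Q (x : A)

lemma isFQ_QP (h : IsFQ Q) (p : ℕ) : IsFQ (QP Q p) where
  quad n x := h.quad n x
  bil x x' y := h.bil x x' y

lemma Bf_nsmul (h : IsFQ Q) (n : ℕ) (x y : A) : Bf Q (n • x) y = n • Bf Q x y :=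
  (Bh h y).map_nsmul n x

lemma perp_QP [Finite A] (h : IsFQ Q) (p : ℕ) (hp : p.Prime) (L : AddSubgroup A)
    (x : primaryComp A p) :
    x ∈ perp (isFQ_QP h p) (L.addSubgroupOf (primaryComp A p)) ↔ (x : A) ∈ perp h L := by
  constructor
  · intro H l hl
    obtain ⟨k, hk⟩ := x.2
    set n := Nat.card A with hn
    have hn0 : n ≠ 0 := Nat.card_pos.ne'
    set m := n / p ^ n.factorization p with hm
    have hcop : Nat.Coprime p m := Nat.coprime_ordCompl hp hn0
    have h1 : p ^ n.factorization p • (m • l) = 0 := by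
      rw [← mul_smul, Nat.ordProj_mul_ordCompl_eq_self]
      exact card_nsmul_eq_zero'
    have h2 : m • Bf Q l x = 0 := by
      rw [← Bf_nsmul h]
      exact H ⟨m • l, _, h1⟩ (AddSubgroup.mem_addSubgroupOf.2 (L.nsmul_mem hl m))
    have h3 : p ^ k • Bf Q l x = 0 := by
      rw [Bf_comm, ← Bf_nsmul h, hk]
      exact (Bh h l).map_zero
    have h5 : addOrderOf (Bf Q l x) ∣ 1 := by
      rw [← (Nat.Coprime.pow_left k hcop : Nat.gcd (p ^ k) m = 1)]
      exact Nat.dvd_gcd (addOrderOf_dvd_of_nsmul_eq_zero h3) (addOrderOf_dvd_of_nsmul_eq_zero h2)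
    exact AddMonoid.addOrderOf_eq_one_iff.1 (Nat.dvd_one.1 h5)
  · intro H l hl
    exact H l (AddSubgroup.mem_addSubgroupOf.1 hl)

lemma nd_QP [Finite A] (h : IsFQ Q) (hnd : ∀ x : A, (∀ y : A, Bf Q x y = 0) → x = 0)
    (p : ℕ) (hp : p.Prime) :
    ∀ x : primaryComp A p, (∀ y, Bf (QP Q p) x y = 0) → x = 0 := by
  intro x hx
  have h1 := (perp_QP h p hp ⊤ x).1 (by
    intro y _
    rw [Bf_comm]
    exact hx y)
  apply Subtype.ext
  apply hnd
  intro y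
  rw [Bf_comm]
  exact h1 y trivial

lemma sigma_of_metabolic [Finite A] (h : IsFQ Q)
    (hnd : ∀ x : A, (∀ y : A, Bf Q x y = 0) → x = 0)
    (L : AddSubgroup A) (hL : ∀ x ∈ L, Q x = 0) (hLL : perp h L = L)
    (p : ℕ) (hp : p.Prime) : gaussSigma (QP Q p) = 1 := by
  classical
  have := Fintype.ofFinite (primaryComp A p)
  set P := primaryComp A p
  set LP := L.addSubgroupOf P with hLP
  have h1 : perp (isFQ_QP h p) LP = LP := by
    ext x
    rw [perp_QP h p hp, hLL]; rfl
  have h2 := card_perp (isFQ_QP h p) (nd_QP h hnd p hp) LP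
  have h3 := gauss_perp (isFQ_QP h p) LP (fun x hx => hL x hx)
  have h4 : ∑ x : perp (isFQ_QP h p) LP, ee (-(QP Q p (x : P))) = (Nat.card LP : ℂ) := by
    have : ∀ x : perp (isFQ_QP h p) LP, ee (-(QP Q p (x : P))) = 1 := by
      intro x
      have hx : (x : P) ∈ LP := h1.le x.2
      have : QP Q p (x : P) = 0 := hL _ hx
      rw [this, neg_zero, ee_zero]
    rw [Finset.sum_congr rfl (fun x _ => this x)]
    simp only [Finset.sum_const, nsmul_eq_mul, mul_one, Finset.card_univ]
    rw [← Nat.card_eq_fintype_card, h1]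
  rw [h1] at h2
  unfold gaussSigma
  rw [finsum_eq_sum_of_fintype, h3, h4, ← h2]
  push_cast
  rw [Real.sqrt_mul_self (Nat.cast_nonneg _)]
  have : Nat.card LP ≠ 0 := Nat.card_pos.ne'
  have : (Nat.card LP : ℂ) ≠ 0 := by exact_mod_cast this
  push_cast
  exact inv_mul_cancel₀ this

lemma exists_max [Finite A] (h : IsFQ Q) : ∃ L : AddSubgroup A, (∀ x ∈ L, Q x = 0) ∧
    ∀ x ∈ perp h L, Q x = 0 → x ∈ L := by
  have hfin : Finite (AddSubgroup A) := inferInstance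
  have hQ0 : Q 0 = 0 := by
    have := h.quad 0 0
    simpa using this
  obtain ⟨L, hL⟩ := Set.Finite.exists_maximal (s := {L : AddSubgroup A | ∀ x ∈ L, Q x = 0})
    (Set.toFinite _) ⟨⊥, by
      intro x hx
      rw [AddSubgroup.mem_bot.1 hx, hQ0]⟩
  refine ⟨L, hL.1, ?_⟩
  intro x hx hQ
  have h1 : L ⊔ AddSubgroup.zmultiples x ∈ {L : AddSubgroup A | ∀ x ∈ L, Q x = 0} := by
    intro z hz
    obtain ⟨l, hl, y, hy, rfl⟩ := AddSubgroup.mem_sup.1 hz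
    obtain ⟨n, rfl⟩ := AddSubgroup.mem_zmultiples_iff.1 hy
    rw [Q_add (Q := Q), hL.1 l hl, h.quad, hQ, (perp h L).zsmul_mem hx n l hl]
    simp
  exact hL.2 h1 le_sup_left (AddSubgroup.mem_sup_right (AddSubgroup.mem_zmultiples x))

lemma metabolic_of_sigma [Finite A] (h : IsFQ Q)
    (hnd : ∀ x : A, (∀ y : A, Bf Q x y = 0) → x = 0)
    (hsq : ∃ k : ℕ, Nat.card A = k ^ 2)
    (hσ : ∀ p : ℕ, p.Prime → gaussSigma (QP Q p) = 1) :
    ∃ L : AddSubgroup A, (∀ x ∈ L, Q x = 0) ∧ perp h L = L := by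
  classical
  obtain ⟨L, hL, hmax⟩ := exists_max h
  refine ⟨L, hL, le_antisymm ?_ (le_perp h hL)⟩
  obtain ⟨k, hk⟩ := hsq
  have key : ∀ p : ℕ, p.Prime → ∀ x ∈ perp h L, x ∈ primaryComp A p → x ∈ L := by
    intro p hp x hx hxP
    have := Fintype.ofFinite (primaryComp A p)
    set P := primaryComp A p with hPdef
    set LP := L.addSubgroupOf P with hLP
    set W := perp (isFQ_QP h p) LP with hW
    have hcP : Nat.card P = (p ^ k.factorization p) ^ 2 := by
      rw [hPdef, card_primary A p hp, hk, Nat.factorization_pow, ← pow_mul]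
      simp [mul_comm]
    set s := p ^ k.factorization p with hs
    have h2 := card_perp (isFQ_QP h p) (nd_QP h hnd p hp) LP
    have h3 := gauss_perp (isFQ_QP h p) LP (fun x hx => hL x hx)
    have h4 := hσ p hp
    unfold gaussSigma at h4
    have hs0 : 0 < s := pow_pos hp.pos _
    have hsC : (s : ℂ) ≠ 0 := by exact_mod_cast hs0.ne'
    rw [finsum_eq_sum_of_fintype, h3, hcP] at h4
    push_cast at h4
    rw [Real.sqrt_sq (by positivity)] at h4
    have h5 : ∑ x : W, ee (-(QP Q p (x : P))) = (s : ℂ) := by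
      have h6 := congrArg (fun z => (s : ℂ) * z) h4
      push_cast at h6
      rw [mul_inv_cancel_left₀ (by exact_mod_cast hsC), mul_one] at h6
      rw [h6]
    have h7 := trace_bound (fun x : W => -(QP Q p (x : P))) p (2 * (2 * k.factorization p)) hp (by
      intro x
      have hx : (Nat.card P) • (x : P) = 0 := card_nsmul_eq_zero'
      have hx2 : (Nat.card P) • ((x : P) : A) = 0 := congrArg Subtype.val hx
      have h8 := h.quad (Nat.card P) ((x : P) : A)
      rw [natCast_zsmul, hx2] at h8
      have hQ0 : Q 0 = 0 := by
        have := h.quad 0 0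
        simpa using this
      rw [hQ0] at h8
      rw [smul_neg, neg_eq_zero, pow_succ, mul_comm, mul_smul]
      have h9 : p ^ (2 * (2 * k.factorization p)) • Q ((x : P) : A) = 0 := by
        rw [h8, ← natCast_zsmul]
        congr 1
        rw [hcP, hs]
        push_cast
        ring
      change p • (p ^ (2 * (2 * k.factorization p)) • Q ((x : P) : A)) = 0
      rw [h9, smul_zero]) s h5
    have h10 : (Finset.univ.filter (fun x : W => -(QP Q p (x : P)) = 0)).card ≤ Nat.card LP := by
      rw [← Fintype.card_subtype, ← Nat.card_eq_fintype_card]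
      have hmem : ∀ z : {x : W // -(QP Q p (x : P)) = 0}, z.1.1 ∈ LP := by
        intro z
        exact hmax _ ((perp_QP h p hp L _).1 z.1.2) (neg_eq_zero.1 z.2)
      apply Nat.card_le_card_of_injective (fun z : {x : W // -(QP Q p (x : P)) = 0} => (⟨z.1.1, hmem z⟩ : LP))
      intro a b hab
      have hab2 : a.1.1 = b.1.1 := congrArg (fun t : LP => t.1) hab
      exact Subtype.ext (Subtype.ext hab2)
    have h11 : s ≤ Nat.card LP := h7.trans h10
    have h12 : Nat.card W ≤ Nat.card LP := by
      refine le_trans ?_ h11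
      have h13 : Nat.card LP * Nat.card W = s ^ 2 := h2.trans hcP
      have : s * Nat.card W ≤ s * s := by
        rw [← sq, ← h13]
        exact Nat.mul_le_mul_right _ h11
      exact Nat.le_of_mul_le_mul_left this hs0
    have h14 : LP = W := AddSubgroup.eq_of_le_of_card_ge
      (le_perp (isFQ_QP h p) (fun x hx => hL x hx)) h12
    have h15 : (⟨x, hxP⟩ : P) ∈ W := (perp_QP h p hp L _).2 hx
    rw [← h14] at h15
    exact h15
  have key2 : ∀ n : ℕ, 0 < n → ∀ x ∈ perp h L, n • x = 0 → x ∈ L := by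
    intro n
    induction n using Nat.recOnPosPrimePosCoprime with
    | prime_pow p m hp hm =>
      intro _ x hx hn
      exact key p hp x hx ⟨m, hn⟩
    | zero => intro h; exact absurd h (lt_irrefl 0)
    | one =>
      intro _ x _ hn
      rw [one_smul] at hn
      rw [hn]; exact L.zero_mem
    | coprime a b ha hb hab iha ihb =>
      intro _ x hx hn
      have h1 := iha (by omega) (b • x) ((perp h L).nsmul_mem hx b) (by rw [← mul_smul, hn])
      have h2 := ihb (by omega) (a • x) ((perp h L).nsmul_mem hx a)
        (by rw [← mul_smul, mul_comm, hn])
      have h3 := Nat.gcd_eq_gcd_ab a b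
      rw [hab] at h3
      have h4 : x = a.gcdA b • (a • x) + a.gcdB b • (b • x) := by
        rw [← natCast_zsmul x a, ← natCast_zsmul x b, ← mul_smul, ← mul_smul, ← add_smul,
          mul_comm _ (a : ℤ), mul_comm _ (b : ℤ), ← h3]
        simp
      rw [h4]
      exact L.add_mem (L.zsmul_mem h2 _) (L.zsmul_mem h1 _)
  intro x hx
  exact key2 (Nat.card A) Nat.card_pos x hx card_nsmul_eq_zero'

end

section
variable {M N : Type} [AddCommGroup M] [AddCommGroup N] {QM : M → QZ} {QN : N → QZ}

/-- the form `QM ⊕ (-QN)` -/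
def QD (QM : M → QZ) (QN : N → QZ) : M × N → QZ := fun z => QM z.1 - QN z.2

lemma Bf_QD (z w : M × N) : Bf (QD QM QN) z w = Bf QM z.1 w.1 - Bf QN z.2 w.2 := by
  unfold Bf QD
  simp only [Prod.fst_add, Prod.snd_add]
  abel

lemma isFQ_QD (hM : IsFQ QM) (hN : IsFQ QN) : IsFQ (QD QM QN) where
  quad n z := by
    unfold QD
    rw [Prod.smul_fst, Prod.smul_snd, hM.quad, hN.quad, smul_sub]
  bil x x' y := by
    rw [Bf_QD, Bf_QD, Bf_QD, Prod.fst_add, Prod.snd_add, hM.bil, hN.bil]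
    abel

lemma Bf_zero (hM : IsFQ QM) (x : M) : Bf QM x 0 = 0 := by
  rw [Bf_comm]; exact (Bh hM x).map_zero

lemma nd_QD (hM : IsFQ QM) (hN : IsFQ QN)
    (hndM : ∀ x : M, (∀ y : M, Bf QM x y = 0) → x = 0)
    (hndN : ∀ x : N, (∀ y : N, Bf QN x y = 0) → x = 0) :
    ∀ x : M × N, (∀ y : M × N, Bf (QD QM QN) x y = 0) → x = 0 := by
  intro x hx
  apply Prod.ext
  · apply hndM
    intro y
    have := hx (y, 0)
    rw [Bf_QD, Bf_zero hN, sub_zero] at this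
    exact this
  · apply hndN
    intro y
    have := hx (0, y)
    rw [Bf_QD, Bf_zero hM, zero_sub, neg_eq_zero] at this
    exact this

/-- primary component of a product -/
def primProd (p : ℕ) : primaryComp (M × N) p ≃ primaryComp M p × primaryComp N p where
  toFun z := (⟨z.1.1, by
    obtain ⟨k, hk⟩ := z.2
    exact ⟨k, congrArg Prod.fst hk⟩⟩, ⟨z.1.2, by
    obtain ⟨k, hk⟩ := z.2
    exact ⟨k, congrArg Prod.snd hk⟩⟩)
  invFun w := ⟨(w.1, w.2), by
    obtain ⟨k, hk⟩ := w.1.2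
    obtain ⟨l, hl⟩ := w.2.2
    refine ⟨k + l, Prod.ext ?_ ?_⟩
    · change p ^ (k + l) • (w.1 : M) = 0
      rw [pow_add, mul_comm, mul_smul, hk, smul_zero]
    · change p ^ (k + l) • (w.2 : N) = 0
      rw [pow_add, mul_smul, hl, smul_zero]⟩
  left_inv z := rfl
  right_inv w := rfl

lemma sigma_QD [Finite M] [Finite N] (p : ℕ) :
    gaussSigma (QP (QD QM QN) p) =
      gaussSigma (QP QM p) * (starRingEnd ℂ) (gaussSigma (QP QN p)) := by
  classical
  have := Fintype.ofFinite (primaryComp (M × N) p)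
  have := Fintype.ofFinite (primaryComp M p)
  have := Fintype.ofFinite (primaryComp N p)
  unfold gaussSigma
  rw [finsum_eq_sum_of_fintype, finsum_eq_sum_of_fintype, finsum_eq_sum_of_fintype,
    Nat.card_congr (primProd p), Nat.card_prod, map_mul, map_sum, map_inv₀, Complex.conj_ofReal]
  have h1 : ∑ x : primaryComp (M × N) p, ee (-(QP (QD QM QN) p x)) =
      (∑ x, ee (-(QP QM p x))) * ∑ x, (starRingEnd ℂ) (ee (-(QP QN p x))) := by
    rw [Finset.sum_mul_sum, ← Finset.sum_product', Finset.univ_product_univ]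
    apply Fintype.sum_equiv (primProd p)
    intro z
    rw [← ee_neg, ← ee_add]
    congr 1
    change -(QM z.1.1 - QN z.1.2) = - QM z.1.1 + - - QN z.1.2
    abel
  rw [h1]
  push_cast
  rw [Real.sqrt_mul (Nat.cast_nonneg _)]
  push_cast
  rw [mul_inv]
  ring

lemma sigma_norm [Finite N] (hN : IsFQ QN) (hndN : ∀ x : N, (∀ y : N, Bf QN x y = 0) → x = 0)
    (p : ℕ) (hp : p.Prime) :
    gaussSigma (QP QN p) * (starRingEnd ℂ) (gaussSigma (QP QN p)) = 1 := by
  rw [← sigma_QD]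
  let D : AddSubgroup (N × N) := (AddMonoidHom.prod (AddMonoidHom.id N) (AddMonoidHom.id N)).range
  have hD : ∀ x ∈ D, QD QN QN x = 0 := by
    rintro _ ⟨y, rfl⟩
    exact sub_self (QN y)
  apply sigma_of_metabolic (isFQ_QD hN hN) (nd_QD hN hN hndN hndN) D hD _ p hp
  refine le_antisymm ?_ (le_perp _ hD)
  intro z hz
  refine ⟨z.1, ?_⟩
  have : z.1 - z.2 = 0 := by
    apply hndN
    intro y
    have h1 := hz (y, y) ⟨y, rfl⟩
    rw [Bf_QD] at h1
    have h2 := (Bh hN y).map_sub z.1 z.2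
    change Bf QN (z.1 - z.2) y = Bf QN z.1 y - Bf QN z.2 y at h2
    rw [h2, Bf_comm z.1, Bf_comm z.2, h1]
  exact Prod.ext rfl (sub_eq_zero.1 this)

lemma main_iff [Finite M] [Finite N] (hM : IsFQ QM) (hN : IsFQ QN)
    (hndM : ∀ x : M, (∀ y : M, Bf QM x y = 0) → x = 0)
    (hndN : ∀ x : N, (∀ y : N, Bf QN x y = 0) → x = 0) :
    (∃ L : AddSubgroup (M × N), (∀ x ∈ L, QD QM QN x = 0) ∧ perp (isFQ_QD hM hN) L = L) ↔
    ((∃ k : ℕ, Nat.card M * Nat.card N = k ^ 2) ∧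
      ∀ p : ℕ, p.Prime → gaussSigma (QP QM p) = gaussSigma (QP QN p)) := by
  constructor
  · rintro ⟨L, hL, hLL⟩
    constructor
    · refine ⟨Nat.card L, ?_⟩
      have := card_perp (isFQ_QD hM hN) (nd_QD hM hN hndM hndN) L
      rw [hLL, Nat.card_prod] at this
      rw [← this, sq]
    · intro p hp
      have h1 := sigma_of_metabolic (isFQ_QD hM hN) (nd_QD hM hN hndM hndN) L hL hLL p hp
      have h2 := sigma_norm hN hndN p hp
      rw [sigma_QD] at h1
      have h3 : (starRingEnd ℂ) (gaussSigma (QP QN p)) ≠ 0 := right_ne_zero_of_mul_eq_one h2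
      exact mul_right_cancel₀ h3 (h1.trans h2.symm)
  · rintro ⟨⟨k, hk⟩, hσ⟩
    apply metabolic_of_sigma (isFQ_QD hM hN) (nd_QD hM hN hndM hndN)
    · exact ⟨k, by rw [Nat.card_prod, hk]⟩
    · intro p hp
      rw [sigma_QD, hσ p hp, sigma_norm hN hndN p hp]

lemma witt_to_lag [Finite M] [Finite N] (hM : IsFQ QM) (hN : IsFQ QN)
    (hndN : ∀ x : N, (∀ y : N, Bf QN x y = 0) → x = 0)
    (U : AddSubgroup M) (V : AddSubgroup N)
    (Up : AddSubgroup M) (Vp : AddSubgroup N)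
    (hU : ∀ x ∈ U, QM x = 0) (hV : ∀ x ∈ V, QN x = 0)
    (hUp : ∀ y : M, y ∈ Up ↔ ∀ x ∈ U, Bf QM x y = 0)
    (hVp : ∀ y : N, y ∈ Vp ↔ ∀ x ∈ V, Bf QN x y = 0)
    (φ : (Up ⧸ U.addSubgroupOf Up) ≃+ (Vp ⧸ V.addSubgroupOf Vp))
    (hφ : ∀ (x : Up) (y : Vp),
          φ (QuotientAddGroup.mk x) = QuotientAddGroup.mk y → QM (x : M) = QN (y : N)) :
    ∃ L : AddSubgroup (M × N), (∀ x ∈ L, QD QM QN x = 0) ∧ perp (isFQ_QD hM hN) L = L := by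
  have hUUp : U ≤ Up := fun x hx => (hUp x).2 (le_perp hM hU hx)
  have hVVp : V ≤ Vp := fun x hx => (hVp x).2 (le_perp hN hV hx)
  have hVp' : Vp = perp hN V := by ext y; exact hVp y
  let f : Up × Vp →+ (Vp ⧸ V.addSubgroupOf Vp) :=
    (φ.toAddMonoidHom.comp (QuotientAddGroup.mk' _)).comp (AddMonoidHom.fst _ _) -
      (QuotientAddGroup.mk' _).comp (AddMonoidHom.snd _ _)
  let L : AddSubgroup (M × N) := f.ker.map (AddMonoidHom.prodMap Up.subtype Vp.subtype)
  have hmem : ∀ (x : Up) (y : Vp), φ (QuotientAddGroup.mk x) = QuotientAddGroup.mk y →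
      ((x : M), (y : N)) ∈ L := by
    intro x y hxy
    exact ⟨(x, y), sub_eq_zero.2 hxy, rfl⟩
  have hL : ∀ x ∈ L, QD QM QN x = 0 := by
    rintro _ ⟨⟨x, y⟩, hxy, rfl⟩
    exact sub_eq_zero.2 (hφ x y (sub_eq_zero.1 hxy))
  refine ⟨L, hL, le_antisymm ?_ (le_perp _ hL)⟩
  rintro ⟨x, y⟩ hxy
  have hx : x ∈ Up := by
    rw [hUp]
    intro u hu
    have h1 : (u, (0 : N)) ∈ L := by
      apply hmem ⟨u, hUUp hu⟩ 0
      rw [(QuotientAddGroup.eq_zero_iff _).2 (AddSubgroup.mem_addSubgroupOf.2 hu), map_zero]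
      rfl
    have h2 := hxy _ h1
    rw [Bf_QD, Bf_comm (0 : N), Bf_zero hN, sub_zero] at h2
    exact h2
  have hy : y ∈ Vp := by
    rw [hVp]
    intro u hu
    have h1 : ((0 : M), u) ∈ L := by
      apply hmem 0 ⟨u, hVVp hu⟩
      have h0 : (QuotientAddGroup.mk (⟨u, hVVp hu⟩ : Vp) : Vp ⧸ V.addSubgroupOf Vp) = 0 :=
        (QuotientAddGroup.eq_zero_iff _).2 (AddSubgroup.mem_addSubgroupOf.2 hu)
      rw [h0]
      exact map_zero φ
    have h2 := hxy _ h1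
    rw [Bf_QD, Bf_comm (0 : M), Bf_zero hM, zero_sub, neg_eq_zero] at h2
    exact h2
  obtain ⟨y', hy'⟩ := QuotientAddGroup.mk_surjective (φ (QuotientAddGroup.mk ⟨x, hx⟩))
  have h1 : (x, (y' : N)) ∈ L := hmem ⟨x, hx⟩ y' hy'.symm
  have h2 : (x, y) - (x, (y' : N)) ∈ perp (isFQ_QD hM hN) L :=
    AddSubgroup.sub_mem _ hxy (le_perp _ hL h1)
  have h3 : y - y' ∈ V := by
    rw [← perp_perp hN hndN V, ← hVp']
    intro z hz
    obtain ⟨w, hw⟩ := QuotientAddGroup.mk_surjective (φ.symm (QuotientAddGroup.mk ⟨z, hz⟩))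
    have h4 := h2 _ (hmem w ⟨z, hz⟩ (by rw [hw, AddEquiv.apply_symm_apply]))
    rw [Bf_QD] at h4
    simp only [Prod.fst_sub, Prod.snd_sub, sub_self] at h4
    rw [Bf_zero hM, zero_sub, neg_eq_zero] at h4
    exact h4
  apply hmem ⟨x, hx⟩ ⟨y, hy⟩
  rw [← hy', QuotientAddGroup.eq, AddSubgroup.mem_addSubgroupOf]
  change -(y' : N) + y ∈ V
  rwa [neg_add_eq_sub]

lemma lag_to_witt [Finite M] [Finite N] (hM : IsFQ QM) (hN : IsFQ QN)
    (hndM : ∀ x : M, (∀ y : M, Bf QM x y = 0) → x = 0)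
    (hndN : ∀ x : N, (∀ y : N, Bf QN x y = 0) → x = 0)
    (L : AddSubgroup (M × N)) (hL : ∀ x ∈ L, QD QM QN x = 0)
    (hLL : perp (isFQ_QD hM hN) L = L) :
    ∃ (U : AddSubgroup M) (V : AddSubgroup N)
        (Up : AddSubgroup M) (Vp : AddSubgroup N),
      (∀ x ∈ U, QM x = 0) ∧ (∀ x ∈ V, QN x = 0) ∧
      (∀ y : M, y ∈ Up ↔ ∀ x ∈ U, Bf QM x y = 0) ∧
      (∀ y : N, y ∈ Vp ↔ ∀ x ∈ V, Bf QN x y = 0) ∧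
      ∃ φ : (Up ⧸ U.addSubgroupOf Up) ≃+ (Vp ⧸ V.addSubgroupOf Vp),
        ∀ (x : Up) (y : Vp),
          φ (QuotientAddGroup.mk x) = QuotientAddGroup.mk y →
            QM (x : M) = QN (y : N) := by
  have hQM0 : QM 0 = 0 := by simpa using hM.quad 0 0
  have hQN0 : QN 0 = 0 := by simpa using hN.quad 0 0
  let U : AddSubgroup M := L.comap (AddMonoidHom.inl M N)
  let V : AddSubgroup N := L.comap (AddMonoidHom.inr M N)
  let Up : AddSubgroup M := L.map (AddMonoidHom.fst M N)
  let Vp : AddSubgroup N := L.map (AddMonoidHom.snd M N)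
  have hU : perp hM Up = U := by
    ext x
    constructor
    · intro hx
      change (x, (0 : N)) ∈ L
      rw [← hLL]
      intro z hz
      rw [Bf_QD, Bf_zero hN, sub_zero]
      exact hx _ ⟨z, hz, rfl⟩
    · rintro hx _ ⟨z, hz, rfl⟩
      have hx' : (x, (0 : N)) ∈ perp (isFQ_QD hM hN) L := by rw [hLL]; exact hx
      have := hx' z hz
      rw [Bf_QD, Bf_zero hN, sub_zero] at this
      exact this
  have hV : perp hN Vp = V := by
    ext x
    constructor
    · intro hx
      change ((0 : M), x) ∈ L
      rw [← hLL]
      intro z hz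
      rw [Bf_QD, Bf_zero hM, zero_sub, neg_eq_zero]
      exact hx _ ⟨z, hz, rfl⟩
    · rintro hx _ ⟨z, hz, rfl⟩
      have hx' : ((0 : M), x) ∈ perp (isFQ_QD hM hN) L := by rw [hLL]; exact hx
      have := hx' z hz
      rw [Bf_QD, Bf_zero hM, zero_sub, neg_eq_zero] at this
      exact this
  have hUp : perp hM U = Up := by rw [← hU, perp_perp hM hndM]
  have hVp : perp hN V = Vp := by rw [← hV, perp_perp hN hndN]
  let f : L →+ Up ⧸ U.addSubgroupOf Up := (QuotientAddGroup.mk' _).comp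
    (((AddMonoidHom.fst M N).comp L.subtype).codRestrict Up (fun z => ⟨z, z.2, rfl⟩))
  let g : L →+ Vp ⧸ V.addSubgroupOf Vp := (QuotientAddGroup.mk' _).comp
    (((AddMonoidHom.snd M N).comp L.subtype).codRestrict Vp (fun z => ⟨z, z.2, rfl⟩))
  have hf : Function.Surjective f := by
    intro a
    obtain ⟨⟨_, z, hz, rfl⟩, rfl⟩ := QuotientAddGroup.mk_surjective a
    exact ⟨⟨z, hz⟩, rfl⟩
  have hg : Function.Surjective g := by
    intro a
    obtain ⟨⟨_, z, hz, rfl⟩, rfl⟩ := QuotientAddGroup.mk_surjective a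
    exact ⟨⟨z, hz⟩, rfl⟩
  have hfk : ∀ z : L, z ∈ f.ker ↔ ((z : M × N).1, (0 : N)) ∈ L := by
    intro z
    exact (QuotientAddGroup.eq_zero_iff _).trans AddSubgroup.mem_addSubgroupOf
  have hgk : ∀ z : L, z ∈ g.ker ↔ ((0 : M), (z : M × N).2) ∈ L := by
    intro z
    exact (QuotientAddGroup.eq_zero_iff _).trans AddSubgroup.mem_addSubgroupOf
  have hker : f.ker = g.ker := by
    ext z
    rw [hfk, hgk]
    constructor
    · intro h
      have := L.sub_mem z.2 h
      have h2 : (z : M × N) - ((z : M × N).1, (0 : N)) = ((0 : M), (z : M × N).2) := by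
        apply Prod.ext <;> simp
      rwa [h2] at this
    · intro h
      have := L.sub_mem z.2 h
      have h2 : (z : M × N) - ((0 : M), (z : M × N).2) = ((z : M × N).1, (0 : N)) := by
        apply Prod.ext <;> simp
      rwa [h2] at this
  let e1 := QuotientAddGroup.quotientKerEquivOfSurjective f hf
  let e2 := QuotientAddGroup.quotientKerEquivOfSurjective g hg
  let φ := (e1.symm.trans (QuotientAddGroup.quotientAddEquivOfEq hker)).trans e2
  have hφ : ∀ z : L, φ (f z) = g z := by
    intro z
    have h1 : e1.symm (f z) = QuotientAddGroup.mk z := by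
      rw [AddEquiv.symm_apply_eq]; rfl
    change e2 (QuotientAddGroup.quotientAddEquivOfEq hker (e1.symm (f z))) = g z
    rw [h1]
    rfl
  refine ⟨U, V, Up, Vp, ?_, ?_, ?_, ?_, φ, ?_⟩
  · intro x hx
    have := hL _ hx
    change QM x - QN 0 = 0 at this
    rwa [hQN0, sub_zero] at this
  · intro x hx
    have := hL _ hx
    change QM 0 - QN x = 0 at this
    rwa [hQM0, zero_sub, neg_eq_zero] at this
  · intro y
    rw [← hUp]; rfl
  · intro y
    rw [← hVp]; rfl
  · rintro ⟨_, z, hz, rfl⟩ y hxy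
    have h1 := (hφ ⟨z, hz⟩).symm.trans hxy
    have h2 := AddSubgroup.mem_addSubgroupOf.1 (QuotientAddGroup.eq.1 h1)
    change ((0 : M), -z.2 + (y : N)) ∈ L at h2
    have h3 := hL _ (L.add_mem hz h2)
    change QM (z.1 + 0) - QN (z.2 + (-z.2 + y)) = 0 at h3
    rw [add_zero, add_neg_cancel_left] at h3
    exact sub_eq_zero.1 h3

end

end WittAux

/-- two nondegenerate finite quadratic modules are Witt equivalent
(they have isotropic subgroups `U ≤ M`, `V ≤ N` with `U^⊥/U ≅ V^⊥/V` as quadratic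
modules) if and only if `|M|·|N|` is a perfect square and `σ_p(M) = σ_p(N)` for all
primes `p`. -/
theorem witt_equivalence_iff {M N : Type} [AddCommGroup M] [Finite M]
    [AddCommGroup N] [Finite N] (QM : M → QZ) (QN : N → QZ)
    (hquadM : ∀ (n : ℤ) (x : M), QM (n • x) = (n ^ 2 : ℤ) • QM x)
    (hbilM : ∀ x x' y : M, Bf QM (x + x') y = Bf QM x y + Bf QM x' y)
    (hndM : ∀ x : M, (∀ y : M, Bf QM x y = 0) → x = 0)
    (hquadN : ∀ (n : ℤ) (x : N), QN (n • x) = (n ^ 2 : ℤ) • QN x)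
    (hbilN : ∀ x x' y : N, Bf QN (x + x') y = Bf QN x y + Bf QN x' y)
    (hndN : ∀ x : N, (∀ y : N, Bf QN x y = 0) → x = 0) :
    (∃ (U : AddSubgroup M) (V : AddSubgroup N)
        (Up : AddSubgroup M) (Vp : AddSubgroup N),
      (∀ x ∈ U, QM x = 0) ∧ (∀ x ∈ V, QN x = 0) ∧
      (∀ y : M, y ∈ Up ↔ ∀ x ∈ U, Bf QM x y = 0) ∧
      (∀ y : N, y ∈ Vp ↔ ∀ x ∈ V, Bf QN x y = 0) ∧
      ∃ φ : (Up ⧸ U.addSubgroupOf Up) ≃+ (Vp ⧸ V.addSubgroupOf Vp),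
        ∀ (x : Up) (y : Vp),
          φ (QuotientAddGroup.mk x) = QuotientAddGroup.mk y →
            QM (x : M) = QN (y : N)) ↔
    ((∃ k : ℕ, Nat.card M * Nat.card N = k ^ 2) ∧
      ∀ p : ℕ, p.Prime →
        gaussSigma (fun x : primaryComp M p => QM (x : M)) =
          gaussSigma (fun x : primaryComp N p => QN (x : N))) := by

  have hM : WittAux.IsFQ QM := ⟨hquadM, hbilM⟩
  have hN : WittAux.IsFQ QN := ⟨hquadN, hbilN⟩
  refine Iff.trans ?_ (WittAux.main_iff hM hN hndM hndN)
  constructor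
  · rintro ⟨U, V, Up, Vp, hU, hV, hUp, hVp, φ, hφ⟩
    exact WittAux.witt_to_lag hM hN hndN U V Up Vp hU hV hUp hVp φ hφ
  · rintro ⟨L, hL, hLL⟩
    exact WittAux.lag_to_witt hM hN hndM hndN L hL hLL
end
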